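/- arXiv:1112.1676 — 4 statements merged into one kernel-verified Lean document; each statement's English description precedes it below -/
import Mathlib

section
/- Let p be a prime, A a reduced commutative ring with p·1_A = 0, n ≥ 1, and let Σ denote either Σ_s (with p odd and 1 ≤ s ≤ (p−1)/2) or Σ_{1,t} (with t ≥ 1). Let X ∈ Σ. Then for every N ≥ 1 the N-th logarithmic partial sum L_N(X) exists and lies in Σ, and the sequence (L_N(X))_{N≥1} converges V-adically to a matrix l₁(X) which lies in Σ; moreover this V-adic limit is unique. -/
/-- The matrix of `j`-th Witt coordinates of a matrix of Witt vectors. -/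
def wittPi (p : ℕ) {A : Type*} {n : ℕ} (j : ℕ)
    (X : Matrix (Fin n) (Fin n) (WittVector p A)) : Matrix (Fin n) (Fin n) A :=
  X.map fun w => w.coeff j

/-- `Σ_s`: matrices of Witt vectors whose `0`-th Witt coordinate matrix is `s`-step nilpotent. -/
def SigmaS (p : ℕ) {A : Type*} [CommRing A] {n : ℕ} (s : ℕ) :
    Set (Matrix (Fin n) (Fin n) (WittVector p A)) :=
  {X | wittPi p 0 X ^ s = 0}

/-- `Σ_{1,t}`: matrices of Witt vectors whose `0`-th Witt coordinate matrix vanishes and whose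
`1`-st Witt coordinate matrix is `t`-step nilpotent. -/
def SigmaOneT (p : ℕ) {A : Type*} [CommRing A] {n : ℕ} (t : ℕ) :
    Set (Matrix (Fin n) (Fin n) (WittVector p A)) :=
  {X | wittPi p 0 X = 0 ∧ wittPi p 1 X ^ t = 0}

/-- The predicate "`S` is either `Σ_s` (with `p` odd and `1 ≤ s ≤ (p-1)/2`) or `Σ_{1,t}`
(with `t ≥ 1`)". -/
def IsSigmaEither (p : ℕ) {A : Type*} [CommRing A] {n : ℕ}
    (S : Set (Matrix (Fin n) (Fin n) (WittVector p A))) : Prop :=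
  (∃ s : ℕ, Odd p ∧ 1 ≤ s ∧ s ≤ (p - 1) / 2 ∧ S = SigmaS p s) ∨
  (∃ t : ℕ, 1 ≤ t ∧ S = SigmaOneT p t)

/-- A matrix of Witt vectors lies entrywise in `V^d` if the `j`-th Witt coordinates of all its
entries vanish for all `j < d`. -/
def EntrywiseV (p : ℕ) {A : Type*} [Zero A] {n : ℕ} (d : ℕ)
    (X : Matrix (Fin n) (Fin n) (WittVector p A)) : Prop :=
  ∀ j < d, wittPi p j X = 0

/-- V-adic convergence of a sequence of matrices of Witt vectors. -/
def TendstoV (p : ℕ) [Fact p.Prime] {A : Type*} [CommRing A] {n : ℕ}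
    (Y : ℕ → Matrix (Fin n) (Fin n) (WittVector p A))
    (L : Matrix (Fin n) (Fin n) (WittVector p A)) : Prop :=
  ∀ d : ℕ, ∃ N₀ : ℕ, ∀ N ≥ N₀, EntrywiseV p d (Y N - L)

/-- `E` is the sequence of exponential partial sums of `X`:
`N! • E N = ∑_{v=1}^{N} (N!/v!) • X^v` for all `N ≥ 1`. -/
def IsExpPartialSums (p : ℕ) [Fact p.Prime] {A : Type*} [CommRing A] {n : ℕ}
    (X : Matrix (Fin n) (Fin n) (WittVector p A))
    (E : ℕ → Matrix (Fin n) (Fin n) (WittVector p A)) : Prop :=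
  ∀ N, 1 ≤ N → N.factorial • E N =
    ∑ v ∈ Finset.Icc 1 N, (N.factorial / v.factorial) • X ^ v

/-- `Lg` is the sequence of logarithmic partial sums of `X`:
`N! • Lg N = ∑_{v=1}^{N} (-1)^(v-1) • (N!/v) • X^v` for all `N ≥ 1`. -/
def IsLogPartialSums (p : ℕ) [Fact p.Prime] {A : Type*} [CommRing A] {n : ℕ}
    (X : Matrix (Fin n) (Fin n) (WittVector p A))
    (Lg : ℕ → Matrix (Fin n) (Fin n) (WittVector p A)) : Prop :=
  ∀ N, 1 ≤ N → (N.factorial : ℤ) • Lg N =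
    ∑ v ∈ Finset.Icc 1 N, ((-1 : ℤ) ^ (v - 1) * ((N.factorial / v : ℕ) : ℤ)) • X ^ v

/-- `L` is the V-adic limit of the exponential partial sums of `X`. -/
def IsExpLimit (p : ℕ) [Fact p.Prime] {A : Type*} [CommRing A] {n : ℕ}
    (X L : Matrix (Fin n) (Fin n) (WittVector p A)) : Prop :=
  ∃ E : ℕ → Matrix (Fin n) (Fin n) (WittVector p A),
    IsExpPartialSums p X E ∧ TendstoV p E L

/-- `L` is the V-adic limit of the logarithmic partial sums of `X`. -/
def IsLogLimit (p : ℕ) [Fact p.Prime] {A : Type*} [CommRing A] {n : ℕ}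
    (X L : Matrix (Fin n) (Fin n) (WittVector p A)) : Prop :=
  ∃ Lg : ℕ → Matrix (Fin n) (Fin n) (WittVector p A),
    IsLogPartialSums p X Lg ∧ TendstoV p Lg L

namespace WittVector

variable {p : ℕ} [hp : Fact p.Prime] {A : Type*} [CommRing A] {n : ℕ}

local notation "𝕄" => Matrix (Fin n) (Fin n) (WittVector p A)

theorem entrywiseV_iff_truncate {d : ℕ} {X : 𝕄} :
    EntrywiseV p d X ↔ (truncate d).mapMatrix X = 0 := by
  constructor
  · intro h
    ext i j : 1
    have : X i j ∈ RingHom.ker (truncate (p := p) (R := A) d) :=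
      (mem_ker_truncate _ _).2 fun k hk => congrFun (congrFun (h k hk) i) j
    simpa using this
  · intro h k hk
    ext i j
    have : X i j ∈ RingHom.ker (truncate (p := p) (R := A) d) := by
      simpa using congrFun (congrFun h i) j
    exact (mem_ker_truncate _ _).1 this k hk

theorem entrywiseV_sub_iff {d : ℕ} {X Y : 𝕄} :
    EntrywiseV p d (X - Y) ↔ ∀ j < d, wittPi p j X = wittPi p j Y := by
  rw [entrywiseV_iff_truncate, map_sub, sub_eq_zero]
  constructor
  · intro h k hk
    ext i j
    have := congrArg (TruncatedWittVector.coeff ⟨k, hk⟩) (congrFun (congrFun h i) j)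
    simpa [wittPi] using this
  · intro h
    ext i j : 1
    refine TruncatedWittVector.ext fun k => ?_
    simpa [wittPi] using congrFun (congrFun (h k k.2) i) j

theorem wittPi_zero_eq (X : 𝕄) : wittPi p 0 X = (constantCoeff (p := p)).mapMatrix X := rfl

/-- A sequence of matrices that is Cauchy for the `V`-adic topology converges. -/
theorem exists_tendstoV (Y : ℕ → 𝕄)
    (hY : ∀ d, ∃ N₀, ∀ N ≥ N₀, EntrywiseV p d (Y N - Y N₀)) : ∃ L, TendstoV p Y L := by
  choose N₀ hN₀ using hY
  refine ⟨Matrix.of fun i j => mk p fun k => (Y (N₀ (k + 1)) i j).coeff k, fun d => ?_⟩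
  refine ⟨N₀ d, fun N hN => entrywiseV_sub_iff.2 fun k hk => ?_⟩
  have h₁ := entrywiseV_sub_iff.1 (hN₀ d _ hN) k hk
  have h₂ := entrywiseV_sub_iff.1 (hN₀ d _ (le_max_left (N₀ d) (N₀ (k + 1)))) k hk
  have h₃ := entrywiseV_sub_iff.1 (hN₀ (k + 1) _ (le_max_right (N₀ d) (N₀ (k + 1)))) k (by omega)
  rw [h₁, ← h₂, h₃]
  ext i j
  simp [wittPi]

theorem tendstoV_unique {Y : ℕ → 𝕄} {L L' : 𝕄} (h : TendstoV p Y L) (h' : TendstoV p Y L') :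
    L' = L := by
  ext i j k
  obtain ⟨N, hN⟩ := h (k + 1)
  obtain ⟨N', hN'⟩ := h' (k + 1)
  have h₁ := entrywiseV_sub_iff.1 (hN _ (le_max_left N N')) k (by omega)
  have h₂ := entrywiseV_sub_iff.1 (hN' _ (le_max_right N N')) k (by omega)
  exact congrFun (congrFun (h₂.symm.trans h₁) i) j

/-- The conclusion of the theorem follows from the existence of a `V`-adic null sequence `T` with
`v • T v = X ^ v` whose signed partial sums lie in `S`. -/
theorem log_partial_sums_of_terms {S : Set 𝕄} {X : 𝕄}
    (hS : ∀ L L' : 𝕄, EntrywiseV p 2 (L - L') → L ∈ S → L' ∈ S) (T : ℕ → 𝕄)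
    (hT : ∀ v, 1 ≤ v → v • T v = X ^ v)
    (hT₀ : ∀ d, ∃ N₀, ∀ v ≥ N₀, EntrywiseV p d (T v))
    (hTS : ∀ N, 1 ≤ N → ∑ v ∈ Finset.Icc 1 N, (-1 : ℤ) ^ (v - 1) • T v ∈ S) :
    ∃ Lg : ℕ → 𝕄, IsLogPartialSums p X Lg ∧ (∀ N, 1 ≤ N → Lg N ∈ S) ∧
      ∃ L, L ∈ S ∧ TendstoV p Lg L ∧ ∀ L', TendstoV p Lg L' → L' = L := by
  set Lg : ℕ → 𝕄 := fun N => ∑ v ∈ Finset.Icc 1 N, (-1 : ℤ) ^ (v - 1) • T v with hLg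
  have hcauchy : ∀ d, ∃ N₀, ∀ N ≥ N₀, EntrywiseV p d (Lg N - Lg N₀) := by
    intro d
    obtain ⟨N₀, hN₀⟩ := hT₀ d
    refine ⟨N₀, fun N hN => ?_⟩
    rw [entrywiseV_iff_truncate]
    induction N, hN using Nat.le_induction with
    | base => simp
    | succ N hN ih =>
      have h := entrywiseV_iff_truncate.1 (hN₀ (N + 1) (by omega))
      have hs : Lg (N + 1) = Lg N + (-1 : ℤ) ^ N • T (N + 1) := by
        simp [hLg, Finset.sum_Icc_succ_top (Nat.le_add_left 1 N)]
      rw [hs, add_sub_right_comm, map_add, ih, map_zsmul, h, smul_zero, zero_add]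
  obtain ⟨L, hL⟩ := exists_tendstoV Lg hcauchy
  refine ⟨Lg, fun N _ => ?_, hTS, L, ?_, hL, fun L' h' => tendstoV_unique hL h'⟩
  · rw [hLg, Finset.smul_sum]
    refine Finset.sum_congr rfl fun v hv => ?_
    obtain ⟨hv₁, hvN⟩ := Finset.mem_Icc.1 hv
    have hdvd : N.factorial / v * v = N.factorial :=
      Nat.div_mul_cancel (Nat.dvd_factorial hv₁ hvN)
    rw [← hT v hv₁, ← natCast_zsmul (T v) v, smul_smul, smul_smul]
    congr 1
    nth_rw 1 [← hdvd]
    push_cast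
    ring
  · obtain ⟨N, hN⟩ := hL 2
    exact hS _ _ (hN _ (le_max_left N 1)) (hTS _ (le_max_right N 1))

/-- The Verschiebung acting entrywise on matrices of Witt vectors. -/
noncomputable def matrixV : 𝕄 →+ 𝕄 := (verschiebung (p := p)).mapMatrix

/-- The Frobenius acting entrywise on matrices of Witt vectors. -/
noncomputable def matrixF : 𝕄 →+* 𝕄 := (frobenius (p := p)).mapMatrix

theorem matrixV_mul (X Y : 𝕄) : matrixV X * Y = matrixV (X * matrixF Y) := by
  ext i j : 1
  simp [matrixV, matrixF, Matrix.mul_apply, verschiebung_mul_frobenius]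

theorem matrixF_matrixV (X : 𝕄) : matrixF (matrixV X) = p • X := by
  ext i j : 1
  simp [matrixV, matrixF, frobenius_verschiebung, mul_comm]

theorem matrixV_pow_succ (X : 𝕄) (k : ℕ) :
    matrixV X ^ (k + 1) = p ^ k • matrixV (X ^ (k + 1)) := by
  induction k with
  | zero => simp
  | succ k ih =>
    rw [pow_succ, ih, smul_mul_assoc, matrixV_mul, matrixF_matrixV, mul_smul_comm, map_nsmul,
      smul_smul, ← pow_succ, ← pow_succ]

theorem exists_matrixV_eq {X : 𝕄} (hX : wittPi p 0 X = 0) : ∃ Y, X = matrixV Y := by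
  refine ⟨X.map fun x => mk p fun k => x.coeff (k + 1), ?_⟩
  ext i j k
  cases k with
  | zero => simpa [matrixV, wittPi] using congrFun (congrFun hX i) j
  | succ k => simp [matrixV, verschiebung_coeff_succ]

theorem wittPi_zero_matrixV (X : 𝕄) : wittPi p 0 (matrixV X) = 0 := by
  ext i j
  simp [wittPi, matrixV]

theorem wittPi_one_matrixV (X : 𝕄) : wittPi p 1 (matrixV X) = wittPi p 0 X := by
  ext i j
  exact verschiebung_coeff_succ (X i j) 0

theorem entrywiseV_matrixV_smul [CharP A p] (z : WittVector p A) (k : ℕ) (X : 𝕄) :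
    EntrywiseV p (k + 1) (matrixV ((z * (p : WittVector p A) ^ k) • X)) := by
  intro j hj
  ext a b
  cases j with
  | zero => simp [wittPi, matrixV]
  | succ j =>
    have : z * (p : WittVector p A) ^ k * X a b = (z * X a b) * (p : WittVector p A) ^ k := by ring
    simp only [wittPi, matrixV, Matrix.map_apply, AddMonoidHom.mapMatrix_apply, Matrix.smul_apply,
      smul_eq_mul, verschiebung_coeff_succ, Matrix.zero_apply, this]
    exact mul_pow_charP_coeff_zero _ (by omega)

theorem exists_natCast_mul_eq_one [CharP A p] {m : ℕ} (hm : ¬ p ∣ m) :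
    ∃ z : WittVector p A, (m : WittVector p A) * z = 1 := by
  have h : IsUnit (m : WittVector p (ZMod p)) := by
    refine isUnit_of_coeff_zero_ne_zero _ ?_
    have : (m : WittVector p (ZMod p)).coeff 0 = (m : ZMod p) :=
      map_natCast (constantCoeff (p := p) (R := ZMod p)) m
    rwa [this, Ne, ZMod.natCast_eq_zero_iff]
  have h' := h.map (WittVector.map (ZMod.castHom (dvd_refl p) A))
  rw [map_natCast] at h'
  exact h'.exists_right_inv

theorem exists_natCast_mul_eq_pow [CharP A p] {v : ℕ} (hv : 1 ≤ v) :
    ∃ z : WittVector p A, (v : WittVector p A) * z = (p : WittVector p A) ^ padicValNat p v := by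
  obtain ⟨m, hm⟩ := pow_padicValNat_dvd (p := p) (n := v)
  have hpm : ¬ p ∣ m := by
    rintro ⟨c, rfl⟩
    refine pow_succ_padicValNat_not_dvd (p := p) (n := v) (by omega) ⟨c, ?_⟩
    rw [pow_succ, mul_assoc]
    exact hm
  obtain ⟨z, hz⟩ := exists_natCast_mul_eq_one (A := A) hpm
  refine ⟨z, ?_⟩
  have hcast := congrArg (Nat.cast (R := WittVector p A)) hm
  push_cast at hcast
  rw [hcast, mul_assoc, hz, mul_one]

theorem exists_nsmul_eq_pow [CharP A p] {X Y : 𝕄} {s : ℕ} (hs : 1 ≤ s)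
    (hXY : X ^ s = matrixV Y) {v : ℕ} (hv : s ≤ v) (he : (padicValNat p v + 1) * s ≤ v) :
    ∃ z : WittVector p A, v • matrixV ((z * (p : WittVector p A) ^ (v / s - 1 - padicValNat p v)) •
      (Y ^ (v / s) * matrixF X ^ (v % s))) = X ^ v := by
  obtain ⟨z, hz⟩ := exists_natCast_mul_eq_pow (p := p) (A := A) (hs.trans hv)
  refine ⟨z, ?_⟩
  have hk : padicValNat p v + 1 ≤ v / s := (Nat.le_div_iff_mul_le hs).2 he
  obtain ⟨k, hk'⟩ : ∃ k, v / s = k + 1 := ⟨v / s - 1, by omega⟩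
  have hXv : X ^ v = p ^ k • matrixV (Y ^ (v / s) * matrixF X ^ (v % s)) := by
    conv_lhs => rw [← Nat.div_add_mod v s]
    rw [pow_add, pow_mul, hXY, hk', matrixV_pow_succ, smul_mul_assoc, matrixV_mul, map_pow]
  have hscal : (v : WittVector p A) * (z * (p : WittVector p A) ^ (v / s - 1 - padicValNat p v)) =
      ((p ^ k : ℕ) : WittVector p A) := by
    rw [← mul_assoc, hz, ← pow_add, Nat.cast_pow]
    congr 1
    omega
  rw [hXv, ← map_nsmul, ← map_nsmul, ← Nat.cast_smul_eq_nsmul (WittVector p A) v, smul_smul, hscal,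
    Nat.cast_smul_eq_nsmul]

end WittVector

theorem padicValNat_add_one_le_self (p : ℕ) [hp : Fact p.Prime] {v : ℕ} (hv : 1 ≤ v) :
    padicValNat p v + 1 ≤ v :=
  calc padicValNat p v + 1 ≤ p ^ padicValNat p v := Nat.lt_pow_self hp.out.one_lt
    _ ≤ v := Nat.le_of_dvd hv pow_padicValNat_dvd

theorem padicValNat_add_one_mul_le {p s v : ℕ} [hp : Fact p.Prime] (hs : s ≤ (p - 1) / 2)
    (hv : 1 ≤ v) (hsv : s ≤ v) : (padicValNat p v + 1) * s ≤ v := by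
  have hle : p ^ padicValNat p v ≤ v := Nat.le_of_dvd hv pow_padicValNat_dvd
  rcases h : padicValNat p v with _ | e
  · simpa
  · rw [h] at hle
    have h₁ : e + 1 ≤ p ^ e := Nat.lt_pow_self hp.out.one_lt
    have h₂ : 2 * s ≤ p := by omega
    calc (e + 1 + 1) * s ≤ (e + 1) * (2 * s) := by nlinarith
      _ ≤ p ^ e * p := Nat.mul_le_mul h₁ h₂
      _ ≤ v := by rwa [← pow_succ]

/-- The quotient `v / s` outgrows the `p`-adic valuation of `v`. -/
theorem exists_forall_padicValNat_add_le_div (p : ℕ) [hp : Fact p.Prime] {s : ℕ} (hs : 1 ≤ s)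
    (d : ℕ) : ∃ N₀, ∀ v ≥ N₀, padicValNat p v + d ≤ v / s := by
  have hsq : ∀ e : ℕ, (e + 1) ^ 2 ≤ 4 * 2 ^ e := by
    intro e
    induction e with
    | zero => norm_num
    | succ e ih =>
      rcases Nat.lt_or_ge e 2 with h | h
      · interval_cases e <;> norm_num
      · rw [pow_succ 2 e]; nlinarith
  refine ⟨16 * s ^ 2 + 2 * s * d, fun v hv => ?_⟩
  have hv₀ : 0 < v := by nlinarith [Nat.zero_le (2 * s * d)]
  rw [Nat.le_div_iff_mul_le hs]
  have hle : 2 ^ padicValNat p v ≤ v :=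
    (Nat.pow_le_pow_left hp.out.two_le _).trans (Nat.le_of_dvd hv₀ pow_padicValNat_dvd)
  have hq := hsq (padicValNat p v)
  generalize padicValNat p v = e at *
  have hse : 2 * (s * e) ≤ v := by
    refine (Nat.pow_le_pow_iff_left (n := 2) (by norm_num)).1 ?_
    calc (2 * (s * e)) ^ 2 = 4 * s ^ 2 * e ^ 2 := by ring
      _ ≤ 4 * s ^ 2 * (4 * v) := Nat.mul_le_mul_left _
        ((Nat.pow_le_pow_left (Nat.le_succ e) 2).trans (hq.trans (Nat.mul_le_mul_left 4 hle)))
      _ = 16 * s ^ 2 * v := by ring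
      _ ≤ v * v := Nat.mul_le_mul_right _ (by omega)
      _ = v ^ 2 := by ring
  have hsd : 2 * (s * d) ≤ v := by nlinarith
  nlinarith

theorem sum_smul_pow_pow_eq_zero {R M : Type*} [CommRing R] [Ring M] [Algebra R M] {B : M} {t : ℕ}
    (hB : B ^ t = 0) (c : ℕ → R) (N : ℕ) : (∑ v ∈ Finset.Icc 1 N, c v • B ^ v) ^ t = 0 := by
  have h : ∑ v ∈ Finset.Icc 1 N, c v • B ^ v = B * ∑ v ∈ Finset.Icc 1 N, c v • B ^ (v - 1) := by
    rw [Finset.mul_sum]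
    refine Finset.sum_congr rfl fun v hv => ?_
    rw [mul_smul_comm, mul_pow_sub_one (by have := (Finset.mem_Icc.1 hv).1; omega)]
  have hc : Commute B (∑ v ∈ Finset.Icc 1 N, c v • B ^ (v - 1)) :=
    Commute.sum_right _ _ _ fun v _ => (Commute.self_pow B (v - 1)).smul_right _
  rw [h, hc.mul_pow, hB, zero_mul]

open WittVector in
theorem log_partial_sums_sigmaS {p : ℕ} [hp : Fact p.Prime] {A : Type*} [CommRing A] [CharP A p]
    {n s : ℕ} (hs : 1 ≤ s) (hsp : s ≤ (p - 1) / 2) {X : Matrix (Fin n) (Fin n) (WittVector p A)}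
    (hX : X ∈ SigmaS p s) :
    ∃ Lg : ℕ → Matrix (Fin n) (Fin n) (WittVector p A),
      IsLogPartialSums p X Lg ∧ (∀ N, 1 ≤ N → Lg N ∈ SigmaS p s) ∧
      ∃ L, L ∈ SigmaS p s ∧ TendstoV p Lg L ∧ ∀ L', TendstoV p Lg L' → L' = L := by
  have hX' : wittPi p 0 X ^ s = 0 := hX
  obtain ⟨Y, hY⟩ : ∃ Y, X ^ s = matrixV Y :=
    exists_matrixV_eq (by rw [wittPi_zero_eq, map_pow, ← wittPi_zero_eq, hX'])
  have hterm : ∀ v, ∃ T : Matrix (Fin n) (Fin n) (WittVector p A), (1 ≤ v → v • T = X ^ v) ∧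
      (s ≤ v → EntrywiseV p (v / s - padicValNat p v) T) ∧
      ∃ c : A, 1 ≤ v → wittPi p 0 T = c • wittPi p 0 X ^ v := by
    intro v
    rcases Nat.lt_or_ge v s with h | h
    · rcases Nat.eq_zero_or_pos v with rfl | hv
      · exact ⟨0, by simp, by omega, 0, by simp⟩
      · have hpv : ¬ p ∣ v := fun hd => by have := Nat.le_of_dvd hv hd; omega
        obtain ⟨z, hz⟩ := exists_natCast_mul_eq_one (A := A) hpv
        refine ⟨z • X ^ v, fun _ => ?_, by omega, z.coeff 0, fun _ => ?_⟩
        · rw [← Nat.cast_smul_eq_nsmul (WittVector p A), smul_smul, hz, one_smul]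
        · rw [wittPi_zero_eq X, ← map_pow]
          ext i j
          exact mul_coeff_zero z ((X ^ v) i j)
    · have he := padicValNat_add_one_mul_le hsp (hs.trans h) h
      obtain ⟨z, hz⟩ := exists_nsmul_eq_pow hs hY h he
      refine ⟨_, fun _ => hz, fun _ => ?_, 0, fun _ => ?_⟩
      · have hk := (Nat.le_div_iff_mul_le hs).2 he
        convert entrywiseV_matrixV_smul z _ _ using 1
        omega
      · rw [wittPi_zero_matrixV, zero_smul]
  choose T hT hTV c hc using hterm
  refine log_partial_sums_of_terms ?_ T hT (fun d => ?_) fun N _ => ?_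
  · intro L L' h hL
    change wittPi p 0 L' ^ s = 0
    rwa [← entrywiseV_sub_iff.1 h 0 (by norm_num)]
  · obtain ⟨N₀, hN₀⟩ := exists_forall_padicValNat_add_le_div p hs d
    refine ⟨max N₀ s, fun v hv j hj => hTV v (by omega) j ?_⟩
    have := hN₀ v (by omega)
    omega
  · have hsum : wittPi p 0 (∑ v ∈ Finset.Icc 1 N, (-1 : ℤ) ^ (v - 1) • T v) =
        ∑ v ∈ Finset.Icc 1 N, ((-1 : ℤ) ^ (v - 1) • c v) • wittPi p 0 X ^ v := by
      rw [wittPi_zero_eq, map_sum]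
      refine Finset.sum_congr rfl fun v hv => ?_
      rw [map_zsmul, ← wittPi_zero_eq, hc v (Finset.mem_Icc.1 hv).1, smul_assoc]
    change wittPi p 0 _ ^ s = 0
    rw [hsum]
    exact sum_smul_pow_pow_eq_zero hX' _ N

open WittVector in
theorem log_partial_sums_sigmaOneT {p : ℕ} [hp : Fact p.Prime] {A : Type*} [CommRing A] [CharP A p]
    {n t : ℕ} {X : Matrix (Fin n) (Fin n) (WittVector p A)} (hX : X ∈ SigmaOneT p t) :
    ∃ Lg : ℕ → Matrix (Fin n) (Fin n) (WittVector p A),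
      IsLogPartialSums p X Lg ∧ (∀ N, 1 ≤ N → Lg N ∈ SigmaOneT p t) ∧
      ∃ L, L ∈ SigmaOneT p t ∧ TendstoV p Lg L ∧ ∀ L', TendstoV p Lg L' → L' = L := by
  obtain ⟨hX₀, hX₁⟩ := hX
  obtain ⟨Y, rfl⟩ := exists_matrixV_eq hX₀
  rw [wittPi_one_matrixV] at hX₁
  have hterm : ∀ v, ∃ z : WittVector p A, 1 ≤ v →
      v • matrixV ((z * (p : WittVector p A) ^ (v - 1 - padicValNat p v)) • Y ^ v) =
        matrixV Y ^ v := by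
    intro v
    rcases Nat.eq_zero_or_pos v with rfl | hv
    · exact ⟨0, by simp⟩
    · obtain ⟨z, hz⟩ := exists_nsmul_eq_pow le_rfl (pow_one (matrixV Y)) hv
        (by simpa using padicValNat_add_one_le_self p hv)
      exact ⟨z, fun _ => by simpa [Nat.mod_one] using hz⟩
  choose z hz using hterm
  refine log_partial_sums_of_terms ?_ _ hz (fun d => ?_) fun N _ => ?_
  · rintro L L' h ⟨h₀, h₁⟩
    exact ⟨by rw [← entrywiseV_sub_iff.1 h 0 (by norm_num), h₀],
      by rw [← entrywiseV_sub_iff.1 h 1 (by norm_num), h₁]⟩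
  · obtain ⟨N₀, hN₀⟩ := exists_forall_padicValNat_add_le_div p le_rfl d
    refine ⟨N₀, fun v hv j hj => entrywiseV_matrixV_smul _ _ _ j ?_⟩
    have := hN₀ v hv
    rw [Nat.div_one] at this
    omega
  · simp_rw [← map_zsmul, ← map_sum]
    refine ⟨wittPi_zero_matrixV _, ?_⟩
    rw [wittPi_one_matrixV, wittPi_zero_eq, map_sum]
    convert sum_smul_pow_pow_eq_zero hX₁ (fun v => (-1 : ℤ) ^ (v - 1) •
      (z v * (p : WittVector p A) ^ (v - 1 - padicValNat p v)).coeff 0) N using 3 with v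
    rw [map_zsmul, smul_assoc, wittPi_zero_eq Y, ← map_pow]
    congr 1
    ext i j
    exact mul_coeff_zero _ ((Y ^ v) i j)

/-- Proposition B.2 (b), logarithmic part: for `X ∈ Σ`, the logarithmic partial sums exist,
lie in `Σ`, and converge V-adically to a unique limit, which lies in `Σ`. -/
theorem log_partial_sums_exist_and_converge (p : ℕ) [Fact p.Prime] (A : Type*) [CommRing A]
    [CharP A p] [IsReduced A] (n : ℕ) (hn : 1 ≤ n)
    (S : Set (Matrix (Fin n) (Fin n) (WittVector p A))) (hS : IsSigmaEither p S)
    (X : Matrix (Fin n) (Fin n) (WittVector p A)) (hX : X ∈ S) :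
    ∃ Lg : ℕ → Matrix (Fin n) (Fin n) (WittVector p A),
      IsLogPartialSums p X Lg ∧ (∀ N, 1 ≤ N → Lg N ∈ S) ∧
      ∃ L, L ∈ S ∧ TendstoV p Lg L ∧ ∀ L', TendstoV p Lg L' → L' = L := by
  rcases hS with ⟨s, -, hs, hsp, rfl⟩ | ⟨t, -, rfl⟩
  · exact log_partial_sums_sigmaS hs hsp hX
  · exact log_partial_sums_sigmaOneT hX
end

section
/- Let p be an odd prime, n ≥ 1, and s an integer with 1 ≤ s ≤ (p−1)/2. Let D_s := {X ∈ M_n(ℚ_p) : all entries of X lie in ℤ_p and the reduction X̄ ∈ M_n(𝔽_p) satisfies X̄^s = 0}. Then: (i) for every X ∈ D_s the series Σ_{v≥1} (1/v!)·X^v converges in M_n(ℚ_p) to a matrix e(X), and e(X) ∈ D_s; (ii) for every X ∈ D_s the series Σ_{v≥1} ((−1)^{v−1}/v)·X^v converges in M_n(ℚ_p) to a matrix l(X), and l(X) ∈ D_s; (iii) l(e(X)) = X and e(l(X)) = X for every X ∈ D_s, so e and l are mutually inverse bijections of D_s onto itself. -/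
open Filter

/-- `D_s`: matrices over `ℚ_p` with entries in `ℤ_p` whose reduction modulo `p` is
`s`-step nilpotent. -/
def padicDs (p : ℕ) [Fact p.Prime] (n s : ℕ) : Set (Matrix (Fin n) (Fin n) ℚ_[p]) :=
  {X | ∃ Y : Matrix (Fin n) (Fin n) ℤ_[p],
    (∀ i j, X i j = (Y i j : ℚ_[p])) ∧
    (Y.map fun y => PadicInt.toZMod y) ^ s = 0}

/-- Partial sums of the exponential series `∑_{v ≥ 1} (1/v!)·X^v`. -/
noncomputable def padicExpSums (p : ℕ) [Fact p.Prime] {n : ℕ}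
    (X : Matrix (Fin n) (Fin n) ℚ_[p]) (N : ℕ) : Matrix (Fin n) (Fin n) ℚ_[p] :=
  ∑ v ∈ Finset.Icc 1 N, ((v.factorial : ℚ_[p]))⁻¹ • X ^ v

/-- Partial sums of the logarithmic series `∑_{v ≥ 1} ((−1)^{v−1}/v)·X^v`. -/
noncomputable def padicLogSums (p : ℕ) [Fact p.Prime] {n : ℕ}
    (X : Matrix (Fin n) (Fin n) ℚ_[p]) (N : ℕ) : Matrix (Fin n) (Fin n) ℚ_[p] :=
  ∑ v ∈ Finset.Icc 1 N, (((-1 : ℚ_[p]) ^ (v - 1)) / (v : ℚ_[p])) • X ^ v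

namespace PowerSeries

section FormalInverse

variable {A : Type*} [CommRing A] [Algebra ℚ A]

theorem derivative_log_mul_one_add_X : d⁄dX A (log A) * (1 + X) = 1 := by
  ext n
  rcases n with _ | n
  · simp [deriv_log, mul_add]
  · simp [deriv_log, mul_add, coeff_one, pow_succ]

variable [IsAddTorsionFree A]

theorem log_subst_exp_sub_one : (log A).subst (exp A - 1) = (X : A⟦X⟧) := by
  have hE : HasSubst (exp A - 1) := HasSubst.exp_sub_one
  refine derivative.ext ?_ ?_
  · have h := congrArg (subst (exp A - 1)) (derivative_log_mul_one_add_X (A := A))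
    rw [← coe_substAlgHom hE, map_mul, map_add, map_one, substAlgHom_X, coe_substAlgHom,
      add_sub_cancel] at h
    rw [derivative_subst hE, map_sub, derivative_exp, Derivation.map_one_eq_zero, sub_zero, h,
      derivative_X]
  · rw [constantCoeff_X]
    exact constantCoeff_subst_eq_zero (by simp [← constantCoeff_eq]) _ constantCoeff_log

theorem exp_sub_one_subst_log : (exp A - 1).subst (log A) = (X : A⟦X⟧) := by
  have hL : HasSubst (log A) := HasSubst.log
  have hD := derivative_log_mul_one_add_X (A := A)
  set D := d⁄dX A (log A) with hDdef
  have hdD : d⁄dX A D = - D ^ 2 := by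
    have h := congrArg (d⁄dX A) hD
    simp only [Derivation.leibniz, map_add, Derivation.map_one_eq_zero, derivative_X,
      smul_eq_mul] at h
    linear_combination D * h - d⁄dX A D * hD
  have hder : d⁄dX A ((exp A).subst (log A)) = (exp A).subst (log A) * D := by
    rw [derivative_subst hL, derivative_exp]
  have h0 : constantCoeff ((exp A - 1).subst (log A)) = 0 :=
    constantCoeff_subst_eq_zero (by simp [← constantCoeff_eq]) _ (by simp)
  have hsub : (exp A - 1).subst (log A) = (exp A).subst (log A) - 1 := by
    rw [← coe_substAlgHom hL, map_sub, map_one]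
  rw [hsub] at h0 ⊢
  have h1 : (exp A).subst (log A) * D = 1 := by
    refine derivative.ext ?_ ?_
    · rw [Derivation.leibniz, hder, hdD, Derivation.map_one_eq_zero]
      simp only [smul_eq_mul]
      ring
    · rw [map_sub, map_one, sub_eq_zero] at h0
      rw [map_mul, h0, hDdef, deriv_log, ← coeff_zero_eq_constantCoeff_apply, coeff_mk]
      simp
  linear_combination (1 + X) * h1 - (exp A).subst (log A) * hD

end FormalInverse

section Evaluation

variable {K A : Type*} [NormedField K] [NormedRing A] [NormedAlgebra K A] [CompleteSpace A]

theorem tsum_coeff_smul_mul {F G : K⟦X⟧} {x : A} (hF : Summable fun v ↦ ‖coeff v F • x ^ v‖)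
    (hG : Summable fun v ↦ ‖coeff v G • x ^ v‖) :
    (∑' v, coeff v F • x ^ v) * ∑' v, coeff v G • x ^ v = ∑' v, coeff v (F * G) • x ^ v := by
  rw [tsum_mul_tsum_eq_tsum_sum_antidiagonal_of_summable_norm hF hG]
  congr with v
  rw [coeff_mul, Finset.sum_smul]
  refine Finset.sum_congr rfl fun q hq ↦ ?_
  rw [smul_mul_smul_comm, ← pow_add, Finset.HasAntidiagonal.mem_antidiagonal.mp hq]

theorem tsum_coeff_smul_pow {G : K⟦X⟧} {x : A}
    (hG : ∀ m, Summable fun v ↦ ‖coeff v (G ^ m) • x ^ v‖) (m : ℕ) :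
    (∑' v, coeff v G • x ^ v) ^ m = ∑' v, coeff v (G ^ m) • x ^ v := by
  induction m with
  | zero =>
    rw [pow_zero, pow_zero, tsum_eq_single 0 fun v hv ↦ by simp [coeff_one, hv]]
    simp
  | succ m ih =>
    rw [pow_succ, ih, tsum_coeff_smul_mul (hG m) (by simpa using hG 1), pow_succ]

theorem tsum_coeff_subst {F G : K⟦X⟧} {x : A} (hG0 : constantCoeff G = 0)
    (hG : ∀ m, Summable fun v ↦ ‖coeff v (G ^ m) • x ^ v‖)
    (hFG : Summable fun q : ℕ × ℕ ↦ (coeff q.2 F * coeff q.1 (G ^ q.2)) • x ^ q.1) :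
    ∑' m, coeff m F • (∑' v, coeff v G • x ^ v) ^ m = ∑' v, coeff v (F.subst G) • x ^ v := by
  have hsubst : HasSubst G := HasSubst.of_constantCoeff_zero' hG0
  have hfin (v : ℕ) : (fun m ↦ coeff m F * coeff v (G ^ m)).HasFiniteSupport :=
    coeff_subst_finite' hsubst F v
  calc _ = ∑' m, ∑' v, (coeff m F * coeff v (G ^ m)) • x ^ v := by
        congr with m
        rw [tsum_coeff_smul_pow hG, ← (hG m).of_norm.tsum_const_smul]
        simp [mul_smul]
    _ = ∑' v, ∑' m, (coeff m F * coeff v (G ^ m)) • x ^ v := hFG.tsum_comm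
    _ = _ := by
        congr with v
        rw [coeff_subst' hsubst, tsum_eq_finsum, finsum_smul]
        · simp
        · exact (hfin v).subset fun m hm h ↦ hm (by simp [h])

end Evaluation

end PowerSeries

section Hurwitz

open PowerSeries Nat

variable {p : ℕ} [Fact p.Prime]

/-- A power series over `ℚ_p` is a Hurwitz series if it is of the form `∑ a_v x^v / v!` with
`a_v ∈ ℤ_p`. -/
def IsHurwitz (F : ℚ_[p]⟦X⟧) : Prop :=
  ∀ v : ℕ, (v ! : ℚ_[p]) * coeff v F ∈ PadicInt.subring p

namespace IsHurwitz

theorem one : IsHurwitz (1 : ℚ_[p]⟦X⟧) := by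
  intro v
  rw [coeff_one]
  split_ifs with h
  · simp [h]
  · simp

theorem sub {F G : ℚ_[p]⟦X⟧} (hF : IsHurwitz F) (hG : IsHurwitz G) : IsHurwitz (F - G) := by
  intro v
  rw [map_sub, mul_sub]
  exact sub_mem (hF v) (hG v)

theorem mul {F G : ℚ_[p]⟦X⟧} (hF : IsHurwitz F) (hG : IsHurwitz G) : IsHurwitz (F * G) := by
  intro v
  rw [coeff_mul, Finset.mul_sum]
  refine sum_mem fun q hq ↦ ?_
  rw [Finset.HasAntidiagonal.mem_antidiagonal] at hq
  have h : (v ! : ℚ_[p]) = (v.choose q.1 : ℚ_[p]) * q.1 ! * q.2 ! := by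
    rw [← hq]
    exact_mod_cast (Nat.choose_symm_add (a := q.1) (b := q.2) ▸
      Nat.add_choose_mul_factorial_mul_factorial q.1 q.2).symm
  have : (v ! : ℚ_[p]) * (coeff q.1 F * coeff q.2 G) =
      v.choose q.1 * ((q.1 ! * coeff q.1 F) * (q.2 ! * coeff q.2 G)) := by
    rw [h]; ring
  rw [this]
  exact mul_mem (natCast_mem _ _) (mul_mem (hF _) (hG _))

theorem pow {F : ℚ_[p]⟦X⟧} (hF : IsHurwitz F) (m : ℕ) : IsHurwitz (F ^ m) := by
  induction m with
  | zero => simpa using one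
  | succ m ih => simpa [pow_succ] using ih.mul hF

theorem derivative {F : ℚ_[p]⟦X⟧} (hF : IsHurwitz F) : IsHurwitz (d⁄dX ℚ_[p] F) := by
  intro v
  have := hF (v + 1)
  rw [Nat.factorial_succ] at this
  rw [coeff_derivative]
  convert this using 1
  push_cast
  ring

theorem of_derivative {F : ℚ_[p]⟦X⟧} (hF : IsHurwitz (d⁄dX ℚ_[p] F))
    (h0 : constantCoeff F = 0) : IsHurwitz F := by
  rintro (_ | v)
  · simp [h0]
  · have := hF v
    rw [coeff_derivative] at this
    rw [Nat.factorial_succ]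
    convert this using 1
    push_cast
    ring

theorem inv_factorial_smul_pow {G : ℚ_[p]⟦X⟧} (hG : IsHurwitz G) (h0 : constantCoeff G = 0)
    (m : ℕ) : IsHurwitz ((m ! : ℚ_[p])⁻¹ • G ^ m) := by
  induction m with
  | zero => simpa using one
  | succ m ih =>
    refine of_derivative ?_ (by simp [h0])
    convert ih.mul hG.derivative using 1
    have hm : (m + 1 : ℚ_[p]) ≠ 0 := by exact_mod_cast m.succ_ne_zero
    have hm' : (m ! : ℚ_[p]) ≠ 0 := by exact_mod_cast m.factorial_ne_zero
    rw [Derivation.map_smul, derivative_pow, Nat.factorial_succ, smul_mul_assoc,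
      Nat.add_sub_cancel, mul_assoc, ← nsmul_eq_mul, ← Nat.cast_smul_eq_nsmul ℚ_[p], smul_smul]
    congr 1
    push_cast
    field_simp

theorem coeff_smul_pow {F G : ℚ_[p]⟦X⟧} (hF : IsHurwitz F) (hG : IsHurwitz G)
    (h0 : constantCoeff G = 0) (m : ℕ) : IsHurwitz (coeff m F • G ^ m) := by
  intro v
  have hm' : (m ! : ℚ_[p]) ≠ 0 := by exact_mod_cast m.factorial_ne_zero
  convert mul_mem (hF m) (hG.inv_factorial_smul_pow h0 m v) using 1
  simp only [map_smul, smul_eq_mul]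
  field_simp

theorem exp : IsHurwitz (exp ℚ_[p]) := by
  intro v
  have : (v ! : ℚ_[p]) ≠ 0 := by exact_mod_cast v.factorial_ne_zero
  rw [coeff_exp]
  simp [this]

theorem log : IsHurwitz (log ℚ_[p]) := by
  refine of_derivative (fun v ↦ ?_) constantCoeff_log
  rw [deriv_log, coeff_mk]
  simpa using mul_mem (natCast_mem (PadicInt.subring p) v !)
    (pow_mem (neg_mem (one_mem (PadicInt.subring p))) v)

theorem pow_mul_coeff_mem {F : ℚ_[p]⟦X⟧} (hF : IsHurwitz F) {v k : ℕ}
    (hk : padicValNat p v ! ≤ k) : (p : ℚ_[p]) ^ k * coeff v F ∈ PadicInt.subring p := by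
  have hv : (v ! : ℚ_[p]) ≠ 0 := by exact_mod_cast v.factorial_ne_zero
  have h : (p : ℚ_[p]) ^ k / v ! ∈ PadicInt.subring p := by
    have hp : (p : ℚ_[p]) ≠ 0 := by exact_mod_cast (Fact.out : p.Prime).ne_zero
    change ‖_‖ ≤ 1
    rw [Padic.norm_le_one_iff_val_nonneg, div_eq_mul_inv,
      Padic.valuation_mul (pow_ne_zero k hp) (inv_ne_zero hv), Padic.valuation_inv,
      Padic.valuation_pow, Padic.valuation_p, Padic.valuation_natCast]
    lia
  convert mul_mem h (hF v) using 1
  field_simp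

end IsHurwitz

theorem padicValNat_factorial_le_div (v : ℕ) : padicValNat p v ! ≤ v / (p - 1) := by
  have hp : 0 < p - 1 := Nat.sub_pos_of_lt (Fact.out : p.Prime).one_lt
  rw [Nat.le_div_iff_mul_le hp, mul_comm, sub_one_mul_padicValNat_factorial]
  exact Nat.sub_le _ _

theorem two_mul_div_le_div {p s v : ℕ} (hs1 : 1 ≤ s) (hs2 : s ≤ (p - 1) / 2) :
    2 * (v / (p - 1)) ≤ v / s := by
  rw [Nat.le_div_iff_mul_le hs1]
  calc 2 * (v / (p - 1)) * s ≤ 2 * (v / (p - 1)) * ((p - 1) / 2) := Nat.mul_le_mul_left _ hs2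
    _ = (v / (p - 1)) * ((p - 1) / 2 * 2) := by ring
    _ ≤ (v / (p - 1)) * (p - 1) := Nat.mul_le_mul_left _ (Nat.div_mul_le_self _ _)
    _ ≤ v := Nat.div_mul_le_self _ _

theorem padicValNat_factorial_add_div_le {s : ℕ} (hs1 : 1 ≤ s) (hs2 : s ≤ (p - 1) / 2) (v : ℕ) :
    padicValNat p v ! + v / (p - 1) ≤ v / s := by
  have := padicValNat_factorial_le_div (p := p) v
  have := two_mul_div_le_div (v := v) hs1 hs2
  lia

theorem padicValNat_factorial_add_one_le {s v : ℕ} (hs1 : 1 ≤ s) (hs2 : s ≤ (p - 1) / 2)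
    (hv : s ≤ v) : padicValNat p v ! + 1 ≤ v / s := by
  have := padicValNat_factorial_le_div (p := p) v
  have := two_mul_div_le_div (v := v) hs1 hs2
  have : 1 ≤ v / s := (Nat.one_le_div_iff hs1).mpr hv
  lia

theorem summable_succ_mul_pow_div {q : ℝ} (hq0 : 0 < q) (hq1 : q < 1) {k : ℕ} (hk : 0 < k) :
    Summable fun v : ℕ ↦ ((v : ℝ) + 1) * q ^ (v / k) := by
  set r : ℝ := q ^ (1 / (k : ℝ)) with hr
  have hr0 : 0 < r := Real.rpow_pos_of_pos hq0 _
  have hr1 : r < 1 := Real.rpow_lt_one hq0.le hq1 (by positivity)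
  have hrk : r ^ k = q := by
    rw [hr, ← Real.rpow_natCast, ← Real.rpow_mul hq0.le]
    field_simp
    simp
  have hsum : Summable fun v : ℕ ↦ q⁻¹ * ((v : ℝ) ^ 1 * r ^ v + r ^ v) := by
    have hr : ‖r‖ < 1 := by rwa [Real.norm_of_nonneg hr0.le]
    exact ((summable_pow_mul_geometric_of_norm_lt_one 1 hr).add
      (summable_geometric_of_norm_lt_one hr)).mul_left _
  refine hsum.of_nonneg_of_le (fun v ↦ by positivity) fun v ↦ ?_
  have h : q * q ^ (v / k) ≤ r ^ v := by
    rw [← _root_.pow_succ', ← hrk, ← pow_mul]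
    exact pow_le_pow_of_le_one hr0.le hr1.le (Nat.lt_mul_div_succ v hk).le
  calc ((v : ℝ) + 1) * q ^ (v / k) = q⁻¹ * ((v + 1) * (q * q ^ (v / k))) := by field_simp
    _ ≤ q⁻¹ * ((v + 1) * r ^ v) := by gcongr
    _ = _ := by ring

end Hurwitz

section IntegralMatrices

open PowerSeries

variable {p : ℕ} [Fact p.Prime] {n s : ℕ}

/-- The subring of matrices over `ℚ_p` with entries in `ℤ_p`. -/
noncomputable abbrev integralMatrices (p : ℕ) [Fact p.Prime] (n : ℕ) :
    Subring (Matrix (Fin n) (Fin n) ℚ_[p]) :=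
  (PadicInt.subring p).matrix

theorem smul_mem_integralMatrices {c : ℚ_[p]} (hc : c ∈ PadicInt.subring p)
    {X : Matrix (Fin n) (Fin n) ℚ_[p]} (hX : X ∈ integralMatrices p n) :
    c • X ∈ integralMatrices p n :=
  fun i j ↦ (PadicInt.subring p).mul_mem hc (hX i j)

theorem isClosed_integralMatrices :
    IsClosed (integralMatrices p n : Set (Matrix (Fin n) (Fin n) ℚ_[p])) := by
  have : (integralMatrices p n : Set (Matrix (Fin n) (Fin n) ℚ_[p])) =
      ⋂ i, ⋂ j, {X | ‖X i j‖ ≤ 1} := by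
    ext X
    simp only [Set.mem_iInter]
    rfl
  rw [this]
  exact isClosed_iInter fun i ↦ isClosed_iInter fun j ↦
    isClosed_le (continuous_id.matrix_elem i j).norm continuous_const

theorem toZMod_eq_zero_iff (y : ℤ_[p]) :
    PadicInt.toZMod y = 0 ↔ (p : ℚ_[p])⁻¹ * y ∈ PadicInt.subring p := by
  have hp : (p : ℚ_[p]) ≠ 0 := by exact_mod_cast (Fact.out : p.Prime).ne_zero
  rw [← RingHom.mem_ker, PadicInt.ker_toZMod, PadicInt.maximalIdeal_eq_span_p,
    Ideal.mem_span_singleton]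
  constructor
  · rintro ⟨c, rfl⟩
    rw [PadicInt.coe_mul, PadicInt.coe_natCast, inv_mul_cancel_left₀ hp]
    exact c.2
  · intro h
    refine ⟨⟨_, h⟩, Subtype.ext ?_⟩
    exact (mul_inv_cancel_left₀ hp _).symm

theorem map_toZMod_pow_eq_zero_iff (Y : Matrix (Fin n) (Fin n) ℤ_[p]) :
    (Y.map fun y ↦ PadicInt.toZMod y) ^ s = 0 ↔
      (p : ℚ_[p])⁻¹ • (PadicInt.Coe.ringHom.mapMatrix Y) ^ s ∈ integralMatrices p n := by
  change (PadicInt.toZMod.mapMatrix Y) ^ s = 0 ↔ _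
  rw [← map_pow, ← map_pow, ← Matrix.ext_iff]
  exact forall_congr' fun i ↦ forall_congr' fun j ↦ toZMod_eq_zero_iff _

theorem mem_padicDs_iff {X : Matrix (Fin n) (Fin n) ℚ_[p]} :
    X ∈ padicDs p n s ↔
      X ∈ integralMatrices p n ∧ (p : ℚ_[p])⁻¹ • X ^ s ∈ integralMatrices p n := by
  constructor
  · rintro ⟨Y, hY, h⟩
    obtain rfl : X = PadicInt.Coe.ringHom.mapMatrix Y := by
      ext i j
      exact hY i j
    exact ⟨fun i j ↦ (Y i j).2, (map_toZMod_pow_eq_zero_iff Y).mp h⟩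
  · rintro ⟨hX, h⟩
    exact ⟨fun i j ↦ ⟨X i j, hX i j⟩, fun i j ↦ rfl, (map_toZMod_pow_eq_zero_iff _).mpr h⟩

variable {X : Matrix (Fin n) (Fin n) ℚ_[p]}

theorem inv_pow_smul_pow_mem (hX : X ∈ padicDs p n s) (v : ℕ) :
    ((p : ℚ_[p]) ^ (v / s))⁻¹ • X ^ v ∈ integralMatrices p n := by
  obtain ⟨hX, hXs⟩ := mem_padicDs_iff.mp hX
  have : ((p : ℚ_[p]) ^ (v / s))⁻¹ • X ^ v =
      ((p : ℚ_[p])⁻¹ • X ^ s) ^ (v / s) * X ^ (v % s) := by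
    rw [smul_pow, smul_mul_assoc, ← pow_mul, ← pow_add, Nat.div_add_mod, inv_pow]
  rw [this]
  exact mul_mem (pow_mem hXs _) (pow_mem hX _)

theorem inv_pow_smul_coeff_smul_pow_mem (hX : X ∈ padicDs p n s) {F : ℚ_[p]⟦X⟧}
    (hF : IsHurwitz F) {v k : ℕ} (hk : padicValNat p v.factorial + k ≤ v / s) :
    ((p : ℚ_[p]) ^ k)⁻¹ • coeff v F • X ^ v ∈ integralMatrices p n := by
  have hp : (p : ℚ_[p]) ≠ 0 := by exact_mod_cast (Fact.out : p.Prime).ne_zero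
  convert smul_mem_integralMatrices (hF.pow_mul_coeff_mem (Nat.le_sub_of_add_le hk))
    (inv_pow_smul_pow_mem hX v) using 1
  rw [smul_smul, smul_smul, pow_sub₀ _ hp (by lia)]
  congr 1
  field_simp

open scoped Matrix.Norms.Operator

noncomputable local instance (priority := high) :
    UniformSpace (Matrix (Fin n) (Fin n) ℚ_[p]) :=
  PseudoMetricSpace.toUniformSpace

noncomputable local instance (priority := high) :
    TopologicalSpace (Matrix (Fin n) (Fin n) ℚ_[p]) :=
  PseudoMetricSpace.toUniformSpace.toTopologicalSpace

local instance : CompleteSpace (Matrix (Fin n) (Fin n) ℚ_[p]) :=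
  FiniteDimensional.complete ℚ_[p] _

theorem norm_le_of_inv_pow_smul_mem {k : ℕ}
    (h : ((p : ℚ_[p]) ^ k)⁻¹ • X ∈ integralMatrices p n) : ‖X‖ ≤ n * (p : ℝ)⁻¹ ^ k := by
  have hp : (p : ℚ_[p]) ≠ 0 := by exact_mod_cast (Fact.out : p.Prime).ne_zero
  have hX (i j) : ‖X i j‖ ≤ (p : ℝ)⁻¹ ^ k := by
    have h' : ‖((p : ℚ_[p]) ^ k)⁻¹ * X i j‖ ≤ 1 := h i j
    calc ‖X i j‖ = ‖(p : ℚ_[p]) ^ k * (((p : ℚ_[p]) ^ k)⁻¹ * X i j)‖ := by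
          rw [mul_inv_cancel_left₀ (pow_ne_zero k hp)]
      _ ≤ ‖(p : ℚ_[p]) ^ k‖ * 1 := by rw [norm_mul]; gcongr
      _ = _ := by rw [mul_one, norm_pow, Padic.norm_p]
  have hle : 0 ≤ (n : ℝ) * (p : ℝ)⁻¹ ^ k := by positivity
  rw [Matrix.linfty_opNorm_def, ← NNReal.coe_mk _ hle, NNReal.coe_le_coe]
  refine Finset.sup_le fun i _ ↦ ?_
  rw [← NNReal.coe_le_coe, NNReal.coe_mk, NNReal.coe_sum]
  calc ∑ j, ‖X i j‖ ≤ ∑ _j : Fin n, (p : ℝ)⁻¹ ^ k := Finset.sum_le_sum fun j _ ↦ hX i j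
    _ = _ := by simp

theorem summable_succ_mul_bound :
    Summable fun v : ℕ ↦ ((v : ℝ) + 1) * (n * (p : ℝ)⁻¹ ^ (v / (p - 1))) := by
  have hp : 1 < p := (Fact.out : p.Prime).one_lt
  have := (summable_succ_mul_pow_div (q := (p : ℝ)⁻¹) (by positivity)
    (inv_lt_one_of_one_lt₀ (by exact_mod_cast hp)) (Nat.sub_pos_of_lt hp)).mul_left (n : ℝ)
  exact this.congr fun v ↦ by ring

variable (hs1 : 1 ≤ s) (hs2 : s ≤ (p - 1) / 2) (hX : X ∈ padicDs p n s)
include hs1 hs2 hX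

theorem norm_coeff_smul_pow_le {F : ℚ_[p]⟦X⟧} (hF : IsHurwitz F) (v : ℕ) :
    ‖coeff v F • X ^ v‖ ≤ n * (p : ℝ)⁻¹ ^ (v / (p - 1)) :=
  norm_le_of_inv_pow_smul_mem
    (inv_pow_smul_coeff_smul_pow_mem hX hF (padicValNat_factorial_add_div_le hs1 hs2 v))

theorem summable_norm_coeff_smul_pow {F : ℚ_[p]⟦X⟧} (hF : IsHurwitz F) :
    Summable fun v ↦ ‖coeff v F • X ^ v‖ := by
  refine (summable_succ_mul_bound (p := p) (n := n)).of_nonneg_of_le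
    (fun v ↦ norm_nonneg _) fun v ↦ (norm_coeff_smul_pow_le hs1 hs2 hX hF v).trans ?_
  exact le_mul_of_one_le_left (by positivity) (by simp)

theorem summable_prod_coeff_smul_pow {F G : ℚ_[p]⟦X⟧} (hF : IsHurwitz F) (hG : IsHurwitz G)
    (hG0 : constantCoeff G = 0) :
    Summable fun q : ℕ × ℕ ↦ (coeff q.2 F * coeff q.1 (G ^ q.2)) • X ^ q.1 := by
  refine Summable.of_norm ?_
  have hzero (v m : ℕ) (hm : m ∉ Finset.range (v + 1)) :
      ‖(coeff m F * coeff v (G ^ m)) • X ^ v‖ = 0 := by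
    have : coeff v (G ^ m) = 0 := by
      refine X_pow_dvd_iff.mp (pow_dvd_pow_of_dvd (X_dvd_iff.mpr hG0) m) v ?_
      simpa [Nat.lt_succ_iff] using hm
    simp [this]
  refine (summable_prod_of_nonneg fun _ ↦ norm_nonneg _).mpr
    ⟨fun v ↦ summable_of_ne_finset_zero (hzero v), ?_⟩
  refine (summable_succ_mul_bound (p := p) (n := n)).of_nonneg_of_le
    (fun v ↦ tsum_nonneg fun _ ↦ norm_nonneg _) fun v ↦ ?_
  rw [tsum_eq_sum (hzero v)]
  refine (Finset.sum_le_card_nsmul _ _ _ fun m _ ↦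
    norm_coeff_smul_pow_le hs1 hs2 hX (hF.coeff_smul_pow hG hG0 m) v).trans_eq ?_
  simp

theorem tsum_coeff_smul_pow_mem_padicDs {F : ℚ_[p]⟦X⟧} (hF : IsHurwitz F)
    (hF0 : constantCoeff F = 0) : ∑' v, coeff v F • X ^ v ∈ padicDs p n s := by
  have hsum (m) := summable_norm_coeff_smul_pow hs1 hs2 hX (hF.pow m)
  have hmem {f : ℕ → Matrix (Fin n) (Fin n) ℚ_[p]} (hf : Summable f)
      (h : ∀ v, f v ∈ integralMatrices p n) : ∑' v, f v ∈ integralMatrices p n :=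
    IsClosed.mem_of_tendsto isClosed_integralMatrices hf.hasSum
      (Eventually.of_forall fun t ↦ sum_mem fun v _ ↦ h v)
  refine mem_padicDs_iff.mpr ⟨hmem (by simpa using (hsum 1).of_norm) fun v ↦ ?_, ?_⟩
  · have := padicValNat_factorial_add_div_le (p := p) hs1 hs2 v
    simpa using inv_pow_smul_coeff_smul_pow_mem hX hF (v := v) (k := 0) (by lia)
  · rw [tsum_coeff_smul_pow hsum, ← (hsum s).of_norm.tsum_const_smul]
    refine hmem ((hsum s).of_norm.const_smul _) fun v ↦ ?_
    by_cases hv : s ≤ v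
    · simpa using inv_pow_smul_coeff_smul_pow_mem hX (hF.pow s)
        (padicValNat_factorial_add_one_le hs1 hs2 hv)
    · have : coeff v (F ^ s) = 0 :=
        X_pow_dvd_iff.mp (pow_dvd_pow_of_dvd (X_dvd_iff.mpr hF0) s) v (not_le.mp hv)
      simp [this]

theorem tsum_coeff_smul_tsum_pow {F G : ℚ_[p]⟦X⟧} (hF : IsHurwitz F) (hG : IsHurwitz G)
    (hG0 : constantCoeff G = 0) (hFG : F.subst G = (PowerSeries.X : ℚ_[p]⟦X⟧)) :
    ∑' m, coeff m F • (∑' v, coeff v G • X ^ v) ^ m = X := by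
  rw [tsum_coeff_subst hG0 (fun m ↦ summable_norm_coeff_smul_pow hs1 hs2 hX (hG.pow m))
    (summable_prod_coeff_smul_pow hs1 hs2 hX hF hG hG0), hFG,
    tsum_eq_single 1 fun v hv ↦ by simp [coeff_X, hv]]
  simp

theorem tendsto_sum_coeff_smul_pow {F : ℚ_[p]⟦X⟧} (hF : IsHurwitz F)
    (hF0 : constantCoeff F = 0) :
    Tendsto (fun N ↦ ∑ v ∈ Finset.Icc 1 N, coeff v F • X ^ v) atTop
      (nhds (∑' v, coeff v F • X ^ v)) := by
  have h := (summable_norm_coeff_smul_pow hs1 hs2 hX hF).of_norm.hasSum.tendsto_sum_nat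
  refine (h.comp (tendsto_add_atTop_nat 1)).congr fun N ↦ ?_
  rw [Function.comp_apply, Finset.sum_range_succ', Finset.range_eq_Ico,
    Finset.sum_Ico_add' (fun v ↦ coeff v F • X ^ v), coeff_zero_eq_constantCoeff_apply, hF0,
    zero_smul, add_zero]
  rfl

omit hs1 hs2 hX

theorem padicExpSums_eq (X : Matrix (Fin n) (Fin n) ℚ_[p]) :
    padicExpSums p X =
      fun N ↦ ∑ v ∈ Finset.Icc 1 N, coeff v (exp ℚ_[p] - 1) • X ^ v := by
  ext1 N
  refine Finset.sum_congr rfl fun v hv ↦ ?_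
  have : v ≠ 0 := by grind
  simp [coeff_exp, coeff_one, this]

theorem padicLogSums_eq (X : Matrix (Fin n) (Fin n) ℚ_[p]) :
    padicLogSums p X = fun N ↦ ∑ v ∈ Finset.Icc 1 N, coeff v (log ℚ_[p]) • X ^ v := by
  ext1 N
  refine Finset.sum_congr rfl fun v hv ↦ ?_
  obtain ⟨v, rfl⟩ : ∃ w, v = w + 1 := ⟨v - 1, by grind⟩
  simp [pow_succ]

end IntegralMatrices

/-- For `p` odd and `1 ≤ s ≤ (p−1)/2`, the exponential and logarithmic series converge on
`D_s`, take values in `D_s`, and define mutually inverse bijections of `D_s` onto itself. -/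
theorem padic_exp_log_Ds (p : ℕ) [Fact p.Prime] (hp : Odd p) (n s : ℕ) (hn : 1 ≤ n)
    (hs1 : 1 ≤ s) (hs2 : s ≤ (p - 1) / 2) :
    (∀ X ∈ padicDs p n s, ∃ eX ∈ padicDs p n s,
      Tendsto (padicExpSums p X) atTop (nhds eX)) ∧
    (∀ X ∈ padicDs p n s, ∃ lX ∈ padicDs p n s,
      Tendsto (padicLogSums p X) atTop (nhds lX)) ∧
    (∀ X ∈ padicDs p n s, ∀ Y Z, Tendsto (padicExpSums p X) atTop (nhds Y) →
      Tendsto (padicLogSums p Y) atTop (nhds Z) → Z = X) ∧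
    (∀ X ∈ padicDs p n s, ∀ Y Z, Tendsto (padicLogSums p X) atTop (nhds Y) →
      Tendsto (padicExpSums p Y) atTop (nhds Z) → Z = X) := by
  have hE : IsHurwitz (PowerSeries.exp ℚ_[p] - 1) := IsHurwitz.exp.sub IsHurwitz.one
  have hE0 : PowerSeries.constantCoeff (PowerSeries.exp ℚ_[p] - 1) = 0 := by simp
  have hL : IsHurwitz (PowerSeries.log ℚ_[p]) := IsHurwitz.log
  have hL0 : PowerSeries.constantCoeff (PowerSeries.log ℚ_[p]) = 0 := by simp
  simp only [padicExpSums_eq, padicLogSums_eq]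
  refine ⟨fun X hX ↦ ⟨_, tsum_coeff_smul_pow_mem_padicDs hs1 hs2 hX hE hE0,
      tendsto_sum_coeff_smul_pow hs1 hs2 hX hE hE0⟩,
    fun X hX ↦ ⟨_, tsum_coeff_smul_pow_mem_padicDs hs1 hs2 hX hL hL0,
      tendsto_sum_coeff_smul_pow hs1 hs2 hX hL hL0⟩,
    fun X hX Y Z hY hZ ↦ ?_, fun X hX Y Z hY hZ ↦ ?_⟩
  · obtain rfl := tendsto_nhds_unique hY (tendsto_sum_coeff_smul_pow hs1 hs2 hX hE hE0)
    rw [tendsto_nhds_unique hZ (tendsto_sum_coeff_smul_pow hs1 hs2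
      (tsum_coeff_smul_pow_mem_padicDs hs1 hs2 hX hE hE0) hL hL0)]
    exact tsum_coeff_smul_tsum_pow hs1 hs2 hX hL hE hE0 PowerSeries.log_subst_exp_sub_one
  · obtain rfl := tendsto_nhds_unique hY (tendsto_sum_coeff_smul_pow hs1 hs2 hX hL hL0)
    rw [tendsto_nhds_unique hZ (tendsto_sum_coeff_smul_pow hs1 hs2
      (tsum_coeff_smul_pow_mem_padicDs hs1 hs2 hX hL hL0) hE hE0)]
    exact tsum_coeff_smul_tsum_pow hs1 hs2 hX hE hL hL0 PowerSeries.exp_sub_one_subst_log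
end

section
/- Let p be any prime, n ≥ 1, and t ≥ 1 an integer. Let D := {X ∈ M_n(ℚ_p) : all entries of X lie in p·ℤ_p and the reduction of p^{-1}X modulo p in M_n(𝔽_p) satisfies ((p^{-1}X)‾)^t = 0}. Then: (i) for every X ∈ D the series Σ_{v≥1} (1/v!)·X^v converges in M_n(ℚ_p) to a matrix e(X), and e(X) ∈ D; (ii) for every X ∈ D the series Σ_{v≥1} ((−1)^{v−1}/v)·X^v converges in M_n(ℚ_p) to a matrix l(X), and l(X) ∈ D; (iii) l(e(X)) = X and e(l(X)) = X for every X ∈ D, so e and l are mutually inverse bijections of D onto itself. -/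
open Filter

/-- `D`: matrices over `ℚ_p` with entries in `p·ℤ_p` such that the reduction of `p⁻¹·X`
modulo `p` is `t`-step nilpotent. -/
def padicDOneT (p : ℕ) [Fact p.Prime] (n t : ℕ) : Set (Matrix (Fin n) (Fin n) ℚ_[p]) :=
  {X | ∃ Y : Matrix (Fin n) (Fin n) ℤ_[p],
    (∀ i j, X i j = (p : ℚ_[p]) * (Y i j : ℚ_[p])) ∧
    (Y.map fun y => PadicInt.toZMod y) ^ t = 0}

namespace PadicInt

variable {p : ℕ} [Fact p.Prime]

lemma factorial_succ_dvd_pow (v : ℕ) : ((v + 1).factorial : ℤ_[p]) ∣ (p : ℤ_[p]) ^ v := by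
  obtain ⟨k, m, hm, hkm⟩ := Nat.exists_eq_pow_mul_and_not_dvd
    (Nat.factorial_ne_zero (v + 1)) p (Fact.out : p.Prime).ne_one
  have hk : k ≤ v := by
    have h := padicValNat_factorial_lt_of_ne_zero p (n := v + 1) v.succ_ne_zero
    have h2 : k ≤ padicValNat p (v + 1).factorial :=
      (padicValNat_dvd_iff_le (Nat.factorial_ne_zero (v + 1))).mp ⟨m, hkm⟩
    omega
  have hu : IsUnit (m : ℤ_[p]) := by
    rw [isUnit_iff, norm_natCast_eq_one_iff]
    exact ((Fact.out : p.Prime).coprime_iff_not_dvd).mpr hm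
  rw [hkm, Nat.cast_mul, Nat.cast_pow, hu.mul_right_dvd]
  exact pow_dvd_pow _ hk

/-- The number `p ^ (v - 1) / v!` for `v ≥ 1`, and `0` for `v = 0`. -/
noncomputable def expCoeff (p : ℕ) [Fact p.Prime] : ℕ → ℤ_[p]
  | 0 => 0
  | v + 1 => (factorial_succ_dvd_pow (p := p) v).choose

@[simp] lemma expCoeff_zero : expCoeff p 0 = 0 := rfl

lemma factorial_mul_expCoeff (v : ℕ) :
    ((v + 1).factorial : ℤ_[p]) * expCoeff p (v + 1) = (p : ℤ_[p]) ^ v :=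
  (factorial_succ_dvd_pow (p := p) v).choose_spec.symm

lemma expCoeff_one : expCoeff p 1 = 1 := by
  simpa using factorial_mul_expCoeff (p := p) 0

lemma succ_mul_expCoeff (v : ℕ) :
    ((v : ℤ_[p]) + 2) * expCoeff p (v + 2) = p * expCoeff p (v + 1) := by
  have h0 : ((v + 1).factorial : ℤ_[p]) ≠ 0 := by exact_mod_cast Nat.factorial_ne_zero _
  apply mul_left_cancel₀ h0
  have h1 := factorial_mul_expCoeff (p := p) (v + 1)
  rw [Nat.factorial_succ] at h1
  push_cast at h1
  linear_combination h1 - p * factorial_mul_expCoeff (p := p) v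

end PadicInt

namespace PowerSeries

open PadicInt

variable (p : ℕ) [Fact p.Prime]

/-- The power series `(exp (p X) - 1) / p` over `ℤ_[p]`. -/
noncomputable def padicExp : ℤ_[p]⟦X⟧ := mk (expCoeff p)

/-- The power series `log (1 + p X) / p` over `ℤ_[p]`. -/
noncomputable def padicLog : ℤ_[p]⟦X⟧ :=
  mk fun v => (-1) ^ (v - 1) * ((v - 1).factorial : ℤ_[p]) * expCoeff p v

lemma constantCoeff_padicExp : constantCoeff (padicExp p) = 0 := by
  simp [padicExp, ← coeff_zero_eq_constantCoeff_apply]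

lemma constantCoeff_padicLog : constantCoeff (padicLog p) = 0 := by
  simp [padicLog, ← coeff_zero_eq_constantCoeff_apply]

lemma derivative_padicExp :
    d⁄dX ℤ_[p] (padicExp p) = 1 + C (p : ℤ_[p]) * padicExp p := by
  ext n
  rw [coeff_derivative, map_add, coeff_C_mul, padicExp, coeff_mk, coeff_mk, coeff_one]
  cases n with
  | zero => simp [expCoeff_one]
  | succ n =>
    have := succ_mul_expCoeff (p := p) n
    simp only [Nat.succ_ne_zero, if_false]
    push_cast
    linear_combination this

lemma derivative_padicLog_mul :
    d⁄dX ℤ_[p] (padicLog p) * (1 + C (p : ℤ_[p]) * X) = 1 := by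
  have h (n : ℕ) : coeff n (d⁄dX ℤ_[p] (padicLog p)) = (-1) ^ n * (p : ℤ_[p]) ^ n := by
    have := factorial_mul_expCoeff (p := p) n
    rw [Nat.factorial_succ] at this
    push_cast at this
    rw [coeff_derivative, padicLog, coeff_mk, Nat.add_sub_cancel]
    linear_combination (-1) ^ n * this
  ext n
  rw [mul_add, mul_one, map_add, mul_left_comm, coeff_C_mul, h, coeff_one]
  cases n with
  | zero => simp
  | succ n =>
    rw [coeff_succ_mul_X, h]
    simp only [Nat.succ_ne_zero, if_false]
    ring

lemma hasSubst_padicExp : HasSubst (padicExp p) :=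
  HasSubst.of_constantCoeff_zero' (constantCoeff_padicExp p)

lemma hasSubst_padicLog : HasSubst (padicLog p) :=
  HasSubst.of_constantCoeff_zero' (constantCoeff_padicLog p)

lemma padicLog_subst_padicExp : (padicLog p).subst (padicExp p) = X := by
  have hs := hasSubst_padicExp p
  have h1 : (d⁄dX ℤ_[p] (padicLog p)).subst (padicExp p) * (1 + C (p : ℤ_[p]) * padicExp p)
      = 1 := by
    have h := congrArg (fun f => (f.subst (padicExp p) : ℤ_[p]⟦X⟧)) (derivative_padicLog_mul p)
    simp only [← coe_substAlgHom hs, map_mul, map_add, map_one] at h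
    rw [substAlgHom_X, coe_substAlgHom, subst_C] at h
    exact h
  apply derivative.ext
  · rw [derivative_subst hs, derivative_padicExp, h1, derivative_X]
  · rw [constantCoeff_X]
    exact constantCoeff_subst_eq_zero (constantCoeff_padicExp p) _ (constantCoeff_padicLog p)

lemma padicExp_subst_padicLog : (padicExp p).subst (padicLog p) = X := by
  have hu : IsUnit (coeff 1 (padicLog p)) := by simp [padicLog, expCoeff_one]
  have hl := subst_substInvOfIsUnit_left (padicLog p) (constantCoeff_padicLog p) hu
  have h := subst_comp_subst_apply (hasSubst_padicLog p) (hasSubst_padicExp p)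
    ((padicLog p).substInvOfIsUnit hu)
  rw [padicLog_subst_padicExp, hl, subst_X (hasSubst_padicExp p), X_subst] at h
  rw [h, hl]

end PowerSeries

namespace PowerSeries

section Evaluation

variable {p : ℕ} [Fact p.Prime] {A : Type*} [NormedRing A] [Algebra ℤ_[p] A]

/-- The value at `a` of a power series with coefficients in `ℤ_[p]`. -/
noncomputable def padicEval (a : A) (φ : ℤ_[p]⟦X⟧) : A := ∑' v, coeff v φ • a ^ v

lemma padicEval_X (a : A) : padicEval a (X : ℤ_[p]⟦X⟧) = a := by
  rw [padicEval, tsum_eq_single 1]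
  · simp
  · intro v hv
    simp [coeff_X, hv]

lemma padicEval_one (a : A) : padicEval a (1 : ℤ_[p]⟦X⟧) = 1 := by
  rw [padicEval, tsum_eq_single 0]
  · simp
  · intro v hv
    simp [coeff_one, hv]

variable [IsBoundedSMul ℤ_[p] A]

lemma norm_padicInt_smul_le (r : ℤ_[p]) (x : A) : ‖r • x‖ ≤ ‖x‖ :=
  (norm_smul_le r x).trans (mul_le_of_le_one_left (norm_nonneg _) (PadicInt.norm_le_one r))

lemma summable_norm_coeff_smul_pow {a : A} (ha : Summable fun v => ‖a ^ v‖) (φ : ℤ_[p]⟦X⟧) :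
    Summable fun v => ‖coeff v φ • a ^ v‖ :=
  ha.of_nonneg_of_le (fun _ => norm_nonneg _) fun _ => norm_padicInt_smul_le _ _

variable [CompleteSpace A]

lemma hasSum_padicEval {a : A} (ha : Summable fun v => ‖a ^ v‖) (φ : ℤ_[p]⟦X⟧) :
    HasSum (fun v => coeff v φ • a ^ v) (padicEval a φ) :=
  (summable_norm_coeff_smul_pow ha φ).of_norm.hasSum

lemma padicEval_mul {a : A} (ha : Summable fun v => ‖a ^ v‖) (φ ψ : ℤ_[p]⟦X⟧) :
    padicEval a (φ * ψ) = padicEval a φ * padicEval a ψ := by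
  rw [padicEval, padicEval, padicEval, tsum_mul_tsum_eq_tsum_sum_antidiagonal_of_summable_norm
    (summable_norm_coeff_smul_pow ha φ) (summable_norm_coeff_smul_pow ha ψ)]
  refine tsum_congr fun v => ?_
  rw [coeff_mul, Finset.sum_smul]
  refine Finset.sum_congr rfl fun kl hkl => ?_
  rw [smul_mul_smul_comm, ← pow_add, Finset.HasAntidiagonal.mem_antidiagonal.mp hkl]

lemma padicEval_pow {a : A} (ha : Summable fun v => ‖a ^ v‖) (φ : ℤ_[p]⟦X⟧) (m : ℕ) :
    padicEval a (φ ^ m) = padicEval a φ ^ m := by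
  induction m with
  | zero => rw [pow_zero, pow_zero, padicEval_one]
  | succ m ih => rw [pow_succ, pow_succ, padicEval_mul ha, ih]

lemma padicEval_subst {a : A} (ha : Summable fun v : ℕ => ((v : ℝ) + 1) * ‖a ^ v‖)
    (φ : ℤ_[p]⟦X⟧) {ψ : ℤ_[p]⟦X⟧} (hψ : constantCoeff ψ = 0) :
    padicEval (padicEval a ψ) φ = padicEval a (φ.subst ψ) := by
  have ha' : Summable fun v => ‖a ^ v‖ := by
    refine ha.of_nonneg_of_le (fun _ => norm_nonneg _) fun v => ?_
    exact le_mul_of_one_le_left (norm_nonneg _) (by simp)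
  have hs : HasSubst ψ := HasSubst.of_constantCoeff_zero' hψ
  have hcoeff {m v : ℕ} (h : v < m) : coeff v (ψ ^ m) = 0 :=
    coeff_of_lt_order _ (lt_of_lt_of_le (by exact_mod_cast h)
      (le_order_pow_of_constantCoeff_eq_zero m hψ))
  have hsupp {m v : ℕ} (h : m ∉ Finset.range (v + 1)) :
      (coeff m φ * coeff v (ψ ^ m)) • a ^ v = 0 := by
    rw [hcoeff (by simpa using h), mul_zero, zero_smul]
  have hsum : Summable (Function.uncurry fun v m => (coeff m φ * coeff v (ψ ^ m)) • a ^ v) := by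
    apply Summable.of_norm
    rw [summable_prod_of_nonneg fun _ => norm_nonneg _]
    have hfin (v : ℕ) (m : ℕ) (h : m ∉ Finset.range (v + 1)) :
        ‖(coeff m φ * coeff v (ψ ^ m)) • a ^ v‖ = 0 := by rw [hsupp h, norm_zero]
    refine ⟨fun v => summable_of_ne_finset_zero (hfin v), ?_⟩
    refine ha.of_nonneg_of_le (fun v => tsum_nonneg fun _ => norm_nonneg _) fun v => ?_
    simp only [Function.uncurry_apply_pair]
    rw [tsum_eq_sum (hfin v)]
    refine (Finset.sum_le_card_nsmul _ _ ‖a ^ v‖ fun m _ => norm_padicInt_smul_le _ _).trans ?_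
    simp
  calc padicEval (padicEval a ψ) φ
      = ∑' m, ∑' v, (coeff m φ * coeff v (ψ ^ m)) • a ^ v := by
        refine tsum_congr fun m => ?_
        simp_rw [mul_smul]
        rw [((hasSum_padicEval ha' (ψ ^ m)).const_smul (coeff m φ)).tsum_eq, padicEval_pow ha']
    _ = ∑' v, ∑' m, (coeff m φ * coeff v (ψ ^ m)) • a ^ v := hsum.tsum_comm
    _ = padicEval a (φ.subst ψ) := by
        refine tsum_congr fun v => ?_
        rw [tsum_eq_sum fun m => hsupp, ← Finset.sum_smul, coeff_subst' hs]
        rw [finsum_eq_sum_of_support_subset (s := Finset.range (v + 1))]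
        · simp
        · intro m hm
          by_contra h
          exact hm (by beta_reduce; rw [hcoeff (by simpa using h), smul_zero])

end Evaluation

end PowerSeries

namespace PadicInt

open PowerSeries

variable {p : ℕ} [Fact p.Prime] {n t : ℕ}

/-- Matrices over `ℤ_[p]` whose reduction modulo `p` has vanishing `t`-th power. -/
def ReductionPowEqZero (t : ℕ) (Y : Matrix (Fin n) (Fin n) ℤ_[p]) : Prop :=
  (Y.map fun y => toZMod y) ^ t = 0

lemma reductionPowEqZero_iff {Y : Matrix (Fin n) (Fin n) ℤ_[p]} :
    ReductionPowEqZero t Y ↔ (toZMod (p := p)).mapMatrix (Y ^ t) = 0 := by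
  rw [map_pow]
  rfl

lemma ReductionPowEqZero.exists_pow_eq_smul {Y : Matrix (Fin n) (Fin n) ℤ_[p]}
    (hY : ReductionPowEqZero t Y) : ∃ Z, Y ^ t = (p : ℤ_[p]) • Z := by
  rw [reductionPowEqZero_iff] at hY
  have h (i j : Fin n) : (p : ℤ_[p]) ∣ (Y ^ t) i j := by
    have hij : toZMod ((Y ^ t) i j) = 0 := congrFun (congrFun hY i) j
    rwa [← RingHom.mem_ker, ker_toZMod, maximalIdeal_eq_span_p,
      Ideal.mem_span_singleton] at hij
  choose Z hZ using h
  exact ⟨Matrix.of Z, by ext1 i j; exact hZ i j⟩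

/-- Multiplication by `p`, as a map from matrices over `ℤ_[p]` to matrices over `ℚ_[p]`. -/
noncomputable def matrixMulP :
    Matrix (Fin n) (Fin n) ℤ_[p] →+ Matrix (Fin n) (Fin n) ℚ_[p] :=
  (DistribSMul.toAddMonoidHom _ (p : ℚ_[p])).comp
    (Coe.ringHom (p := p)).mapMatrix.toAddMonoidHom

lemma matrixMulP_apply (Y : Matrix (Fin n) (Fin n) ℤ_[p]) (i j : Fin n) :
    matrixMulP Y i j = (p : ℚ_[p]) * (Y i j : ℚ_[p]) := rfl

lemma continuous_matrixMulP :
    Continuous (matrixMulP (p := p) (n := n)) := by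
  refine continuous_matrix fun i j => ?_
  simp only [matrixMulP_apply]
  exact continuous_const.mul ((continuous_subtype_val (p := fun x : ℚ_[p] => ‖x‖ ≤ 1)).comp
    (continuous_id.matrix_elem i j))

lemma mem_padicDOneT_iff {X : Matrix (Fin n) (Fin n) ℚ_[p]} :
    X ∈ padicDOneT p n t ↔ ∃ Y, ReductionPowEqZero t Y ∧ matrixMulP Y = X := by
  constructor
  · rintro ⟨Y, hX, hY⟩
    exact ⟨Y, hY, by ext1 i j; exact (hX i j).symm⟩
  · rintro ⟨Y, hY, rfl⟩
    exact ⟨Y, fun i j => rfl, hY⟩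

lemma smul_matrixMulP_pow (Y : Matrix (Fin n) (Fin n) ℤ_[p]) {v : ℕ} {g : ℚ_[p]} {c : ℤ_[p]}
    (h : g * (p : ℚ_[p]) ^ v = p * (c : ℚ_[p])) :
    g • matrixMulP Y ^ v = matrixMulP (c • Y ^ v) := by
  have h1 : matrixMulP Y = (p : ℚ_[p]) • (Coe.ringHom (p := p)).mapMatrix Y := rfl
  rw [h1, smul_pow, smul_smul, h, ← map_pow]
  ext1 i j
  rw [matrixMulP_apply, Matrix.smul_apply, Matrix.smul_apply, smul_eq_mul, smul_eq_mul, coe_mul,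
    mul_assoc]
  rfl

section Norm

attribute [local instance] Matrix.linftyOpNormedRing Matrix.linftyOpIsBoundedSMul

lemma completeSpace_matrix : @CompleteSpace (Matrix (Fin n) (Fin n) ℤ_[p])
    (Matrix.linftyOpNormedRing (n := Fin n) (α := ℤ_[p])).toPseudoMetricSpace.toUniformSpace :=
  inferInstanceAs (CompleteSpace (Fin n → Fin n → ℤ_[p]))

attribute [local instance] completeSpace_matrix

lemma matrix_norm_le (W : Matrix (Fin n) (Fin n) ℤ_[p]) : ‖W‖ ≤ n := by
  rw [Matrix.linfty_opNorm_def]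
  suffices h : (Finset.univ.sup fun i => ∑ j, ‖W i j‖₊) ≤ (n : NNReal) by exact_mod_cast h
  refine Finset.sup_le fun i _ => ?_
  refine (Finset.sum_le_card_nsmul _ _ 1 fun j _ => ?_).trans (by simp)
  exact PadicInt.norm_le_one _

lemma ReductionPowEqZero.norm_pow_le {Y : Matrix (Fin n) (Fin n) ℤ_[p]}
    (hY : ReductionPowEqZero t Y) (v : ℕ) : ‖Y ^ v‖ ≤ (p : ℝ)⁻¹ ^ (v / t) * n := by
  obtain ⟨Z, hZ⟩ := hY.exists_pow_eq_smul
  have h : Y ^ v = (p : ℤ_[p]) ^ (v / t) • (Z ^ (v / t) * Y ^ (v % t)) := by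
    conv_lhs => rw [← Nat.div_add_mod v t]
    rw [pow_add, pow_mul, hZ, smul_pow, smul_mul_assoc]
  rw [h]
  refine (norm_smul_le _ _).trans ?_
  rw [norm_pow, norm_p]
  exact mul_le_mul_of_nonneg_left (matrix_norm_le _) (by positivity)

lemma ReductionPowEqZero.summable_mul_norm_pow (ht : 1 ≤ t)
    {Y : Matrix (Fin n) (Fin n) ℤ_[p]} (hY : ReductionPowEqZero t Y) :
    Summable fun v : ℕ => ((v : ℝ) + 1) * ‖Y ^ v‖ := by
  have hp : (1 : ℝ) < p := by exact_mod_cast (Fact.out : p.Prime).one_lt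
  have hp1 : (p : ℝ)⁻¹ < 1 := inv_lt_one_of_one_lt₀ hp
  have ht0 : t ≠ 0 := by omega
  obtain ⟨r, hr0, hrt⟩ : ∃ r : ℝ, 0 < r ∧ r ^ t = (p : ℝ)⁻¹ :=
    ⟨(p : ℝ)⁻¹ ^ ((t : ℝ)⁻¹), by positivity, Real.rpow_inv_natCast_pow (by positivity) ht0⟩
  have hr1 : r < 1 := by
    by_contra! h
    exact absurd (one_le_pow₀ h (n := t)) (by rw [hrt]; exact not_le.mpr hp1)
  have hnorm : ‖r‖ < 1 := by rwa [Real.norm_of_nonneg hr0.le]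
  have hs : Summable fun v : ℕ => ((v : ℝ) + 1) * r ^ v := by
    have h1 := summable_pow_mul_geometric_of_norm_lt_one 1 hnorm
    have h0 := summable_geometric_of_lt_one hr0.le hr1
    refine (h1.add h0).congr fun v => ?_
    ring
  refine (hs.mul_right ((r ^ t)⁻¹ * n)).of_nonneg_of_le (fun v => by positivity) fun v => ?_
  have hb : (p : ℝ)⁻¹ ^ (v / t) ≤ r ^ v * (r ^ t)⁻¹ := by
    rw [le_mul_inv_iff₀ (by positivity), ← hrt, ← pow_mul, ← pow_add]
    refine pow_le_pow_of_le_one hr0.le hr1.le ?_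
    have := Nat.div_add_mod v t
    have := Nat.mod_lt v (show 0 < t by omega)
    omega
  calc ((v : ℝ) + 1) * ‖Y ^ v‖
      ≤ ((v : ℝ) + 1) * ((p : ℝ)⁻¹ ^ (v / t) * n) := by gcongr; exact hY.norm_pow_le v
    _ ≤ ((v : ℝ) + 1) * (r ^ v * (r ^ t)⁻¹ * n) := by gcongr
    _ = ((v : ℝ) + 1) * r ^ v * ((r ^ t)⁻¹ * n) := by ring

lemma ReductionPowEqZero.summable_norm_pow (ht : 1 ≤ t)
    {Y : Matrix (Fin n) (Fin n) ℤ_[p]} (hY : ReductionPowEqZero t Y) :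
    Summable fun v : ℕ => ‖Y ^ v‖ :=
  (hY.summable_mul_norm_pow ht).of_nonneg_of_le (fun _ => norm_nonneg _) fun _ =>
    le_mul_of_one_le_left (norm_nonneg _) (by simp)

lemma ReductionPowEqZero.padicEval (ht : 1 ≤ t) {Y : Matrix (Fin n) (Fin n) ℤ_[p]}
    (hY : ReductionPowEqZero t Y) {φ : ℤ_[p]⟦X⟧} (hφ : constantCoeff φ = 0) :
    ReductionPowEqZero t (padicEval Y φ) := by
  obtain ⟨ψ, rfl⟩ := X_dvd_iff.mpr hφ
  have hs := hY.summable_norm_pow ht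
  rw [reductionPowEqZero_iff] at hY ⊢
  rw [← padicEval_pow hs, mul_pow, padicEval_mul hs, padicEval_pow hs, padicEval_X, map_mul, hY,
    zero_mul]

lemma ReductionPowEqZero.padicEval_padicEval (ht : 1 ≤ t)
    {Y : Matrix (Fin n) (Fin n) ℤ_[p]} (hY : ReductionPowEqZero t Y) {φ ψ : ℤ_[p]⟦X⟧}
    (hψ : constantCoeff ψ = 0) (h : φ.subst ψ = (X : ℤ_[p]⟦X⟧)) :
    PowerSeries.padicEval (PowerSeries.padicEval Y ψ) φ = Y := by
  rw [padicEval_subst (hY.summable_mul_norm_pow ht) φ hψ, h, padicEval_X]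

lemma ReductionPowEqZero.tendsto_sum (ht : 1 ≤ t) {Y : Matrix (Fin n) (Fin n) ℤ_[p]}
    (hY : ReductionPowEqZero t Y) {φ : ℤ_[p]⟦X⟧} (hφ : constantCoeff φ = 0) {g : ℕ → ℚ_[p]}
    (hg : ∀ v, g (v + 1) * (p : ℚ_[p]) ^ (v + 1) = p * (coeff (v + 1) φ : ℤ_[p])) :
    Tendsto (fun N => ∑ v ∈ Finset.Icc 1 N, g v • matrixMulP Y ^ v) atTop
      (nhds (matrixMulP (PowerSeries.padicEval Y φ))) := by
  have h := ((hasSum_padicEval (hY.summable_norm_pow ht) φ).tendsto_sum_nat).comp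
    (tendsto_add_atTop_nat 1)
  refine ((continuous_matrixMulP.tendsto _).comp h).congr fun N => ?_
  rw [Function.comp_apply, Function.comp_apply, map_sum, Finset.sum_range_succ',
    coeff_zero_eq_constantCoeff_apply, hφ, zero_smul, map_zero, add_zero,
    Finset.range_eq_Ico, Finset.sum_Ico_add' (fun v => matrixMulP (coeff v φ • Y ^ v)) 0 N 1]
  refine Finset.sum_congr rfl fun v hv => ?_
  obtain ⟨v, rfl⟩ := Nat.exists_eq_add_of_le' (Finset.mem_Icc.mp hv).1
  exact (smul_matrixMulP_pow Y (hg v)).symm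

lemma ReductionPowEqZero.tendsto_padicExpSums (ht : 1 ≤ t)
    {Y : Matrix (Fin n) (Fin n) ℤ_[p]} (hY : ReductionPowEqZero t Y) :
    Tendsto (padicExpSums p (matrixMulP Y)) atTop
      (nhds (matrixMulP (PowerSeries.padicEval Y (padicExp p)))) := by
  refine hY.tendsto_sum ht (constantCoeff_padicExp p) fun v => ?_
  have h0 : ((v + 1).factorial : ℚ_[p]) ≠ 0 := by exact_mod_cast Nat.factorial_ne_zero _
  have h : ((v + 1).factorial : ℚ_[p]) * (expCoeff p (v + 1) : ℚ_[p]) = (p : ℚ_[p]) ^ v := by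
    exact_mod_cast congrArg (fun x : ℤ_[p] => (x : ℚ_[p])) (factorial_mul_expCoeff (p := p) v)
  rw [padicExp, coeff_mk, inv_mul_eq_iff_eq_mul₀ h0]
  linear_combination -(p : ℚ_[p]) * h

lemma ReductionPowEqZero.tendsto_padicLogSums (ht : 1 ≤ t)
    {Y : Matrix (Fin n) (Fin n) ℤ_[p]} (hY : ReductionPowEqZero t Y) :
    Tendsto (padicLogSums p (matrixMulP Y)) atTop
      (nhds (matrixMulP (PowerSeries.padicEval Y (padicLog p)))) := by
  refine hY.tendsto_sum ht (constantCoeff_padicLog p) fun v => ?_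
  have h0 : ((v : ℚ_[p]) + 1) ≠ 0 := by exact_mod_cast v.succ_ne_zero
  have h : ((v : ℚ_[p]) + 1) * (v.factorial : ℚ_[p]) * (expCoeff p (v + 1) : ℚ_[p])
      = (p : ℚ_[p]) ^ v := by
    have := congrArg (fun x : ℤ_[p] => (x : ℚ_[p])) (factorial_mul_expCoeff (p := p) v)
    rw [Nat.factorial_succ] at this
    exact_mod_cast this
  rw [padicLog, coeff_mk, Nat.add_sub_cancel]
  push_cast
  field_simp
  linear_combination -(p : ℚ_[p]) * h

end Norm

end PadicInt

/-- For any prime `p` and `t ≥ 1`, the exponential and logarithmic series converge on `D`,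
take values in `D`, and define mutually inverse bijections of `D` onto itself. -/
theorem padic_exp_log_DOneT (p : ℕ) [Fact p.Prime] (n t : ℕ) (hn : 1 ≤ n) (ht : 1 ≤ t) :
    (∀ X ∈ padicDOneT p n t, ∃ eX ∈ padicDOneT p n t,
      Tendsto (padicExpSums p X) atTop (nhds eX)) ∧
    (∀ X ∈ padicDOneT p n t, ∃ lX ∈ padicDOneT p n t,
      Tendsto (padicLogSums p X) atTop (nhds lX)) ∧
    (∀ X ∈ padicDOneT p n t, ∀ Y Z, Tendsto (padicExpSums p X) atTop (nhds Y) →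
      Tendsto (padicLogSums p Y) atTop (nhds Z) → Z = X) ∧
    (∀ X ∈ padicDOneT p n t, ∀ Y Z, Tendsto (padicLogSums p X) atTop (nhds Y) →
      Tendsto (padicExpSums p Y) atTop (nhds Z) → Z = X) := by
  have hexp := PowerSeries.constantCoeff_padicExp p
  have hlog := PowerSeries.constantCoeff_padicLog p
  simp only [PadicInt.mem_padicDOneT_iff]
  refine ⟨?_, ?_, ?_, ?_⟩
  · rintro _ ⟨Y, hY, rfl⟩
    exact ⟨_, ⟨_, hY.padicEval ht hexp, rfl⟩, hY.tendsto_padicExpSums ht⟩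
  · rintro _ ⟨Y, hY, rfl⟩
    exact ⟨_, ⟨_, hY.padicEval ht hlog, rfl⟩, hY.tendsto_padicLogSums ht⟩
  · rintro _ ⟨Y, hY, rfl⟩ E L hE hL
    obtain rfl := tendsto_nhds_unique hE (hY.tendsto_padicExpSums ht)
    rw [tendsto_nhds_unique hL ((hY.padicEval ht hexp).tendsto_padicLogSums ht),
      hY.padicEval_padicEval ht hexp (PowerSeries.padicLog_subst_padicExp p)]
  · rintro _ ⟨Y, hY, rfl⟩ L E hL hE
    obtain rfl := tendsto_nhds_unique hL (hY.tendsto_padicLogSums ht)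
    rw [tendsto_nhds_unique hE ((hY.padicEval ht hlog).tendsto_padicExpSums ht),
      hY.padicEval_padicEval ht hlog (PowerSeries.padicExp_subst_padicLog p)]
end

section
/- Let p be a prime, k a perfect field of characteristic p, M a free W(k)-module of finite rank, φ : M → M a σ-semilinear additive map and ϑ : M → M a σ^{-1}-semilinear additive map with φ∘ϑ = ϑ∘φ = p·id_M. For m ≥ 1 let E_m denote the group of W(k)-linear endomorphisms of M/p^m M that commute with the maps φ_m and ϑ_m induced by φ and ϑ on M/p^m M. Let 0 < i < l be integers. Then: (i) for every f ∈ E_i there is a unique endomorphism κ(f) of M/p^l M such that κ(f)(x + p^l M) = p^{l−i}·y + p^l M whenever y ∈ M reduces modulo p^i to f(x + p^i M), and κ(f) ∈ E_l; (ii) the resulting additive map κ : E_i → E_l is injective; (iii) an element f_l ∈ E_l lies in the image of κ if and only if the endomorphism of M/p^{l−i} M obtained from f_l by reduction modulo p^{l−i} is zero. In other words, the sequence 0 → E_i → E_l → E_{l−i}, with first map κ and second map reduction modulo p^{l−i}, is exact. -/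
/-- The submodule `r·M` of a module `M`. -/
def smulTop (R : Type*) [CommRing R] (M : Type*) [AddCommGroup M] [Module R M] (r : R) :
    Submodule R M :=
  LinearMap.range (r • (LinearMap.id : M →ₗ[R] M))

/-- A linear endomorphism `f` of `M/rM` commutes with the maps induced by `φ` and `ϑ`:
whenever `f(x + rM) = y + rM` we have `f(φ(x) + rM) = φ(y) + rM`, and similarly for `ϑ`. -/
def CommutesWithInduced (R : Type*) [CommRing R] (M : Type*) [AddCommGroup M] [Module R M]
    (φ ϑ : M → M) (r : R)
    (f : (M ⧸ smulTop R M r) →ₗ[R] (M ⧸ smulTop R M r)) : Prop :=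
  (∀ x y : M, f (Submodule.Quotient.mk x) = Submodule.Quotient.mk y →
    f (Submodule.Quotient.mk (φ x)) = Submodule.Quotient.mk (φ y)) ∧
  (∀ x y : M, f (Submodule.Quotient.mk x) = Submodule.Quotient.mk y →
    f (Submodule.Quotient.mk (ϑ x)) = Submodule.Quotient.mk (ϑ y))

/-- The defining property of `κ(f) = F`: whenever `y` reduces modulo `r` to `f(x + rM)`, `F`
sends `x + r'M` to `c·y + r'M` (with `c = p^{l-i}`, `r = p^i`, `r' = p^l`). -/
def KappaProp (R : Type*) [CommRing R] (M : Type*) [AddCommGroup M] [Module R M]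
    (r r' c : R) (f : (M ⧸ smulTop R M r) →ₗ[R] (M ⧸ smulTop R M r))
    (F : (M ⧸ smulTop R M r') →ₗ[R] (M ⧸ smulTop R M r')) : Prop :=
  ∀ x y : M, f (Submodule.Quotient.mk x) = Submodule.Quotient.mk y →
    F (Submodule.Quotient.mk x) = Submodule.Quotient.mk (c • y)

section KappaConstruction

variable {R : Type*} [CommRing R] {M : Type*} [AddCommGroup M] [Module R M]

theorem mem_smulTop {r : R} {x : M} : x ∈ smulTop R M r ↔ ∃ y : M, r • y = x := by
  simp [smulTop]

theorem mk_smulTop_eq_iff {r : R} {x y : M} :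
    (Submodule.Quotient.mk x : M ⧸ smulTop R M r) = Submodule.Quotient.mk y ↔
      ∃ z : M, r • z = x - y := by
  rw [Submodule.Quotient.eq, mem_smulTop]

theorem smulTop_mul_le (c r : R) : smulTop R M (c * r) ≤ smulTop R M r := by
  intro x hx
  obtain ⟨y, rfl⟩ := mem_smulTop.1 hx
  exact mem_smulTop.2 ⟨c • y, by rw [smul_smul, mul_comm]⟩

/-- An additive map commuting with `r` passes to the quotient `M/rM`. -/
theorem mk_smulTop_map_eq {r : R} (ψ : M →+ M) (hψ : ∀ x, ψ (r • x) = r • ψ x) {x y : M}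
    (h : (Submodule.Quotient.mk x : M ⧸ smulTop R M r) = Submodule.Quotient.mk y) :
    (Submodule.Quotient.mk (ψ x) : M ⧸ smulTop R M r) = Submodule.Quotient.mk (ψ y) := by
  obtain ⟨z, hz⟩ := mk_smulTop_eq_iff.1 h
  exact mk_smulTop_eq_iff.2 ⟨ψ z, by rw [← hψ, hz, map_sub]⟩

variable (M) in
/-- Multiplication by `c`, as a map `M/rM → M/crM`. -/
def smulTopMul (c r : R) :
    (M ⧸ smulTop R M r) →ₗ[R] (M ⧸ smulTop R M (c * r)) :=
  Submodule.mapQ _ _ (c • LinearMap.id) fun x hx => by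
    obtain ⟨y, rfl⟩ := mem_smulTop.1 hx
    exact mem_smulTop.2 ⟨y, by simp [smul_smul, mul_comm]⟩

@[simp]
theorem smulTopMul_mk (c r : R) (x : M) :
    smulTopMul M c r (Submodule.Quotient.mk x) = Submodule.Quotient.mk (c • x) :=
  rfl

theorem smulTopMul_injective {c : R} (hc : Function.Injective fun x : M => c • x) (r : R) :
    Function.Injective (smulTopMul M c r) := by
  intro a b h
  obtain ⟨x, rfl⟩ := Submodule.Quotient.mk_surjective _ a
  obtain ⟨y, rfl⟩ := Submodule.Quotient.mk_surjective _ b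
  obtain ⟨z, hz⟩ := mk_smulTop_eq_iff.1 h
  exact mk_smulTop_eq_iff.2 ⟨z, hc (by simpa [smul_smul, smul_sub] using hz)⟩

theorem kappaProp_iff {c r : R} {f : (M ⧸ smulTop R M r) →ₗ[R] (M ⧸ smulTop R M r)}
    {F : (M ⧸ smulTop R M (c * r)) →ₗ[R] (M ⧸ smulTop R M (c * r))} :
    KappaProp R M r (c * r) c f F ↔
      ∀ x : M, F (Submodule.Quotient.mk x) = smulTopMul M c r (f (Submodule.Quotient.mk x)) := by
  refine ⟨fun h x => ?_, fun h x y hxy => by rw [h, hxy, smulTopMul_mk]⟩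
  obtain ⟨y, hy⟩ := Submodule.Quotient.mk_surjective _ (f (Submodule.Quotient.mk x))
  rw [h x y hy.symm, ← hy, smulTopMul_mk]

theorem existsUnique_kappaProp (c r : R)
    (f : (M ⧸ smulTop R M r) →ₗ[R] (M ⧸ smulTop R M r)) :
    ∃! F : (M ⧸ smulTop R M (c * r)) →ₗ[R] (M ⧸ smulTop R M (c * r)),
      KappaProp R M r (c * r) c f F := by
  refine ⟨smulTopMul M c r ∘ₗ f ∘ₗ Submodule.factor (smulTop_mul_le c r),
    kappaProp_iff.2 fun x => rfl, fun F hF => ?_⟩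
  ext x
  exact kappaProp_iff.1 hF x

theorem kappaProp_injective {c r : R} (hc : Function.Injective fun x : M => c • x)
    {f f' : (M ⧸ smulTop R M r) →ₗ[R] (M ⧸ smulTop R M r)}
    {F : (M ⧸ smulTop R M (c * r)) →ₗ[R] (M ⧸ smulTop R M (c * r))}
    (h : KappaProp R M r (c * r) c f F) (h' : KappaProp R M r (c * r) c f' F) : f = f' := by
  ext x
  exact smulTopMul_injective hc r ((kappaProp_iff.1 h x).symm.trans (kappaProp_iff.1 h' x))

theorem exists_kappaProp_iff {c r : R} (hc : Function.Injective fun x : M => c • x)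
    (F : (M ⧸ smulTop R M (c * r)) →ₗ[R] (M ⧸ smulTop R M (c * r))) :
    (∃ f, KappaProp R M r (c * r) c f F) ↔
      ∀ x y : M, F (Submodule.Quotient.mk x) = Submodule.Quotient.mk y →
        (Submodule.Quotient.mk y : M ⧸ smulTop R M c) = 0 := by
  simp only [Submodule.Quotient.mk_eq_zero, mem_smulTop]
  constructor
  · rintro ⟨f, hf⟩ x y hxy
    obtain ⟨z, hz⟩ := Submodule.Quotient.mk_surjective _ (f (Submodule.Quotient.mk x))
    obtain ⟨w, hw⟩ := mk_smulTop_eq_iff.1 (hxy.symm.trans (hf x z hz.symm))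
    exact ⟨z + r • w, by rw [smul_add, smul_smul, hw]; abel⟩
  · intro h
    have hrange : ∀ a, F a ∈ LinearMap.range (smulTopMul M c r) := by
      intro a
      obtain ⟨x, rfl⟩ := Submodule.Quotient.mk_surjective _ a
      obtain ⟨y, hy⟩ := Submodule.Quotient.mk_surjective _ (F (Submodule.Quotient.mk x))
      obtain ⟨z, rfl⟩ := h x y hy.symm
      exact ⟨Submodule.Quotient.mk z, hy⟩
    let e := LinearEquiv.ofInjective (smulTopMul M c r) (smulTopMul_injective hc r)
    let g : M →ₗ[R] (M ⧸ smulTop R M r) :=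
      e.symm.toLinearMap ∘ₗ F.codRestrict _ hrange ∘ₗ Submodule.mkQ _
    have hg : ∀ x, smulTopMul M c r (g x) = F (Submodule.Quotient.mk x) := fun x =>
      congrArg Subtype.val (e.apply_symm_apply (F.codRestrict _ hrange (Submodule.Quotient.mk x)))
    have hker : smulTop R M r ≤ LinearMap.ker g := by
      intro x hx
      obtain ⟨y, rfl⟩ := mem_smulTop.1 hx
      obtain ⟨z, hz⟩ := Submodule.Quotient.mk_surjective _ (g y)
      rw [LinearMap.mem_ker, map_smul, ← hz, ← Submodule.Quotient.mk_smul,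
        Submodule.Quotient.mk_eq_zero]
      exact mem_smulTop.2 ⟨z, rfl⟩
    exact ⟨(smulTop R M r).liftQ g hker, kappaProp_iff.2 fun x => (hg x).symm⟩

/-- If `F = κ(f)`, then `f` and `F` commute with the same additive maps. -/
theorem KappaProp.commutes_iff {c r : R} (hc : Function.Injective fun x : M => c • x)
    {f : (M ⧸ smulTop R M r) →ₗ[R] (M ⧸ smulTop R M r)}
    {F : (M ⧸ smulTop R M (c * r)) →ₗ[R] (M ⧸ smulTop R M (c * r))}
    (h : KappaProp R M r (c * r) c f F) (ψ : M →+ M)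
    (hψc : ∀ x, ψ (c • x) = c • ψ x) (hψr : ∀ x, ψ (r • x) = r • ψ x) :
    (∀ x y : M, F (Submodule.Quotient.mk x) = Submodule.Quotient.mk y →
      F (Submodule.Quotient.mk (ψ x)) = Submodule.Quotient.mk (ψ y)) ↔
    (∀ x y : M, f (Submodule.Quotient.mk x) = Submodule.Quotient.mk y →
      f (Submodule.Quotient.mk (ψ x)) = Submodule.Quotient.mk (ψ y)) := by
  constructor
  · intro hF x y hxy
    apply smulTopMul_injective hc r
    rw [← kappaProp_iff.1 h, hF x _ (h x y hxy), hψc, smulTopMul_mk]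
  · intro hf x y hxy
    obtain ⟨z, hz⟩ := Submodule.Quotient.mk_surjective _ (f (Submodule.Quotient.mk x))
    rw [h _ _ (hf x z hz.symm), ← hψc]
    refine mk_smulTop_map_eq ψ (fun x => ?_) ((h x z hz.symm).symm.trans hxy)
    rw [mul_smul, hψc, hψr, mul_smul]

end KappaConstruction

/-- Property 2.1 (ii) of the paper: exactness of
`0 → End(D[p^i]) → End(D[p^l]) → End(D[p^{l-i}])` at the level of Dieudonné modules.
Here `E_m` is the group of `W(k)`-linear endomorphisms of `M/p^m M` commuting with the maps
induced by `φ` and `ϑ`. -/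
theorem kappa_exact (p : ℕ) [Fact p.Prime] (k : Type*) [Field k] [CharP k p]
    [PerfectRing k p]
    (M : Type*) [AddCommGroup M] [Module (WittVector p k) M]
    [Module.Free (WittVector p k) M] [Module.Finite (WittVector p k) M]
    (φ ϑ : M → M)
    (hφadd : ∀ x y, φ (x + y) = φ x + φ y)
    (hφsemi : ∀ (a : WittVector p k) (x : M), φ (a • x) = WittVector.frobenius a • φ x)
    (hϑadd : ∀ x y, ϑ (x + y) = ϑ x + ϑ y)
    (hϑsemi : ∀ (a : WittVector p k) (x : M), ϑ (WittVector.frobenius a • x) = a • ϑ x)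
    (hφϑ : ∀ x : M, φ (ϑ x) = (p : WittVector p k) • x)
    (hϑφ : ∀ x : M, ϑ (φ x) = (p : WittVector p k) • x)
    (i l : ℕ) (hi : 0 < i) (hil : i < l) :
    -- (i) existence, uniqueness and membership in `E_l` of `κ(f)`
    (∀ f : (M ⧸ smulTop (WittVector p k) M ((p : WittVector p k) ^ i)) →ₗ[WittVector p k]
        (M ⧸ smulTop (WittVector p k) M ((p : WittVector p k) ^ i)),
      CommutesWithInduced (WittVector p k) M φ ϑ ((p : WittVector p k) ^ i) f →
      (∃! F : (M ⧸ smulTop (WittVector p k) M ((p : WittVector p k) ^ l)) →ₗ[WittVector p k]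
          (M ⧸ smulTop (WittVector p k) M ((p : WittVector p k) ^ l)),
        KappaProp (WittVector p k) M ((p : WittVector p k) ^ i) ((p : WittVector p k) ^ l)
          ((p : WittVector p k) ^ (l - i)) f F) ∧
      (∀ F, KappaProp (WittVector p k) M ((p : WittVector p k) ^ i) ((p : WittVector p k) ^ l)
          ((p : WittVector p k) ^ (l - i)) f F →
        CommutesWithInduced (WittVector p k) M φ ϑ ((p : WittVector p k) ^ l) F)) ∧
    -- (ii) injectivity of `κ`
    (∀ f f', CommutesWithInduced (WittVector p k) M φ ϑ ((p : WittVector p k) ^ i) f →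
      CommutesWithInduced (WittVector p k) M φ ϑ ((p : WittVector p k) ^ i) f' →
      ∀ F, KappaProp (WittVector p k) M ((p : WittVector p k) ^ i) ((p : WittVector p k) ^ l)
          ((p : WittVector p k) ^ (l - i)) f F →
        KappaProp (WittVector p k) M ((p : WittVector p k) ^ i) ((p : WittVector p k) ^ l)
          ((p : WittVector p k) ^ (l - i)) f' F →
        f = f') ∧
    -- (iii) the image of `κ` is the kernel of reduction modulo `p^{l-i}`
    (∀ F : (M ⧸ smulTop (WittVector p k) M ((p : WittVector p k) ^ l)) →ₗ[WittVector p k]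
        (M ⧸ smulTop (WittVector p k) M ((p : WittVector p k) ^ l)),
      CommutesWithInduced (WittVector p k) M φ ϑ ((p : WittVector p k) ^ l) F →
      ((∃ f, CommutesWithInduced (WittVector p k) M φ ϑ ((p : WittVector p k) ^ i) f ∧
          KappaProp (WittVector p k) M ((p : WittVector p k) ^ i) ((p : WittVector p k) ^ l)
            ((p : WittVector p k) ^ (l - i)) f F) ↔
        (∀ x y : M, F (Submodule.Quotient.mk x) = Submodule.Quotient.mk y →
          (Submodule.Quotient.mk y :
            M ⧸ smulTop (WittVector p k) M ((p : WittVector p k) ^ (l - i))) = 0))) := by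
  have hφp (m : ℕ) (x : M) :
      φ ((p : WittVector p k) ^ m • x) = (p : WittVector p k) ^ m • φ x := by
    rw [hφsemi, map_pow, map_natCast]
  have hϑp (m : ℕ) (x : M) :
      ϑ ((p : WittVector p k) ^ m • x) = (p : WittVector p k) ^ m • ϑ x := by
    simpa only [map_pow, map_natCast] using hϑsemi ((p : WittVector p k) ^ m) x
  have hc : Function.Injective fun x : M => (p : WittVector p k) ^ (l - i) • x :=
    smul_right_injective M (pow_ne_zero _ (WittVector.p_nonzero p k))
  have hl : (p : WittVector p k) ^ l =
      (p : WittVector p k) ^ (l - i) * (p : WittVector p k) ^ i := by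
    rw [← pow_add, Nat.sub_add_cancel hil.le]
  rw [hl]
  have hcomm {f F} (h : KappaProp (WittVector p k) M ((p : WittVector p k) ^ i)
      ((p : WittVector p k) ^ (l - i) * (p : WittVector p k) ^ i)
      ((p : WittVector p k) ^ (l - i)) f F) :
      CommutesWithInduced (WittVector p k) M φ ϑ _ F ↔
        CommutesWithInduced (WittVector p k) M φ ϑ _ f :=
    and_congr (h.commutes_iff hc (AddMonoidHom.mk' φ hφadd) (hφp _) (hφp _))
      (h.commutes_iff hc (AddMonoidHom.mk' ϑ hϑadd) (hϑp _) (hϑp _))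
  refine ⟨fun f hf => ⟨existsUnique_kappaProp _ _ f, fun F hF => (hcomm hF).2 hf⟩,
    fun f f' _ _ F h h' => kappaProp_injective hc h h', fun F hF => ?_⟩
  rw [← exists_kappaProp_iff hc]
  exact exists_congr fun f => ⟨And.right, fun h => ⟨(hcomm h).1 hF, h⟩⟩
end
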